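/- arXiv:math/0401266 — 5 statements merged into one kernel-verified Lean document; each statement's English description precedes it below -/
import Mathlib

section
/- In the free group F(a,b), for every m, n ≥ 2, the subgroups H = ⟨a, bab⁻¹, ..., b^{m-2}ab^{2-m}, b^{m-1}⟩ and K = ⟨b, aba⁻¹, ..., a^{n-2}ba^{2-n}, a^{n-1}⟩ have ranks m and n respectively, and rank(H ∩ K) - 1 = (m-1)(n-1). -/
/-- The crossed homomorphisms from `G` to the functions `V → A`, written as cocycles on `G × V`. -/
def ActionCocycle (G V A : Type*) [Group G] [MulAction G V] [CommGroup A] : Type _ :=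
  {d : G → V → A // ∀ g h v, d (g * h) v = d g (h • v) * d h v}

namespace ActionCocycle

section

variable {G V A : Type*} [Group G] [MulAction G V] [CommGroup A]

theorem map_one (d : ActionCocycle G V A) (v : V) : d.1 1 v = 1 := by
  simpa using d.2 1 1 v

theorem map_inv (d : ActionCocycle G V A) (g : G) (v : V) : d.1 g⁻¹ v = (d.1 g (g⁻¹ • v))⁻¹ := by
  have h := d.2 g g⁻¹ v
  rw [mul_inv_cancel, d.map_one] at h
  exact eq_inv_of_mul_eq_one_right h.symm

end

/-- A cocycle on a free group is freely determined by its values on the generators. -/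
theorem restrict_bijective {X V A : Type*} [MulAction (FreeGroup X) V] [CommGroup A] :
    Function.Bijective
      (fun (d : ActionCocycle (FreeGroup X) V A) (x : X) (v : V) => d.1 (FreeGroup.of x) v) := by
  constructor
  · intro d e hde
    have key : ∀ g v, d.1 g v = e.1 g v := by
      intro g
      induction g using FreeGroup.induction_on with
      | C1 => intro v; rw [d.map_one, e.map_one]
      | of x => intro v; exact congrFun (congrFun hde x) v
      | inv_of x ih => intro v; rw [d.map_inv, e.map_inv, ih]
      | mul x y hx hy => intro v; rw [d.2, e.2, hx, hy]
    exact Subtype.ext (funext fun g => funext (key g))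
  · intro c
    let P : FreeGroup X →* Equiv.Perm (V × A) := FreeGroup.lift fun x =>
      { toFun := fun p => (FreeGroup.of x • p.1, c x p.1 * p.2)
        invFun := fun p => ((FreeGroup.of x)⁻¹ • p.1, (c x ((FreeGroup.of x)⁻¹ • p.1))⁻¹ * p.2)
        left_inv := fun p => by simp
        right_inv := fun p => by simp }
    have hP : ∀ g : FreeGroup X, ∀ v t, P g (v, t) = (g • v, (P g (v, 1)).2 * t) := by
      intro g
      induction g using FreeGroup.induction_on with
      | C1 => intro v t; simp
      | of x => intro v t; simp [P]
      | inv_of x ih => intro v t; simp [P, Equiv.Perm.inv_def]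
      | mul x y hx hy =>
        intro v t
        have hy1 : P y (v, 1) = (y • v, (P y (v, 1)).2) := by simpa using hy v 1
        rw [map_mul, Equiv.Perm.mul_apply, Equiv.Perm.mul_apply, hy v t, hy1, hx,
          hx (y • v) (P y _).2]
        simp [mul_smul, mul_assoc]
    refine ⟨⟨fun g v => (P g (v, 1)).2, fun g h v => ?_⟩, ?_⟩
    · simp only
      have hh : P h (v, 1) = (h • v, (P h (v, 1)).2) := by simpa using hP h v 1
      rw [map_mul, Equiv.Perm.mul_apply, hh, hP g]
    · funext x v
      simp [P]

/-- A form of Shapiro's lemma: cocycles on the cosets of `N` correspond to characters of `N`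
together with a function on the cosets that is determined up to a constant. -/
theorem nonempty_equiv_hom {G A : Type*} [Group G] [CommGroup A] (N : Subgroup G) :
    Nonempty (ActionCocycle G (G ⧸ N) A × A ≃ (N →* A) × (G ⧸ N → A)) := by
  let o : G ⧸ N := ((1 : G) : G ⧸ N)
  let s : G ⧸ N → G := Quotient.out
  have hs : ∀ v, ((s v : G) : G ⧸ N) = v := fun v => QuotientGroup.out_eq' v
  have hso : ∀ v, s v • o = v := fun v => by
    change ((s v * 1 : G) : G ⧸ N) = v
    rw [mul_one, hs]
  have hsN : s o ∈ N := by simpa using QuotientGroup.eq.1 (hs o)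
  have hn : ∀ n : N, (n : G) • o = o := fun n => by
    change (((n : G) * 1 : G) : G ⧸ N) = ((1 : G) : G ⧸ N)
    rw [mul_one, QuotientGroup.eq]
    simp
  have hmem : ∀ (g : G) (v : G ⧸ N), (s (g • v))⁻¹ * (g * s v) ∈ N := fun g v => by
    rw [← QuotientGroup.eq, hs]
    change g • v = g • ((s v : G) : G ⧸ N)
    rw [hs]
  let r : G → G ⧸ N → N := fun g v => ⟨_, hmem g v⟩
  have hr : ∀ g h v, r (g * h) v = r g (h • v) * r h v := fun g h v => by
    apply Subtype.ext
    simp only [r, Subgroup.coe_mul, mul_smul]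
    group
  let φ : ActionCocycle G (G ⧸ N) A → (N →* A) := fun d =>
    { toFun := fun n => d.1 n o
      map_one' := d.map_one o
      map_mul' := fun x y => by rw [Subgroup.coe_mul, d.2, hn] }
  have hd : ∀ (d : ActionCocycle G (G ⧸ N) A) g v,
      d.1 g v = d.1 (s (g • v)) o * φ d (r g v) * (d.1 (s v) o)⁻¹ := fun d g v => by
    have h1 := d.2 g (s v) o
    have h2 := d.2 (s (g • v)) (r g v) o
    rw [hn] at h2
    have h3 : s (g • v) * (r g v : G) = g * s v := by simp [r]
    rw [h3, h1, hso] at h2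
    exact eq_mul_inv_of_mul_eq h2
  refine ⟨Equiv.ofBijective (fun p => (φ p.1, fun v => p.1.1 (s v) o * p.2)) ⟨?_, ?_⟩⟩
  · rintro ⟨d, t⟩ ⟨e, u⟩ h
    simp only [Prod.mk.injEq] at h
    obtain ⟨h1, h2⟩ := h
    have h4 : d.1 (s o) o = e.1 (s o) o := DFunLike.congr_fun h1 ⟨s o, hsN⟩
    have htu : t = u := by
      have := congrFun h2 o
      simp only [h4] at this
      exact mul_left_cancel this
    subst htu
    have h5 : ∀ v, d.1 (s v) o = e.1 (s v) o := fun v => mul_right_cancel (congrFun h2 v)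
    refine Prod.ext (Subtype.ext (funext fun g => funext fun v => ?_)) rfl
    change d.1 g v = e.1 g v
    rw [hd d, hd e, h5, h5, h1]
  · rintro ⟨ψ, f⟩
    let d : ActionCocycle G (G ⧸ N) A := ⟨fun g v => f (g • v) * ψ (r g v) * (f v)⁻¹,
      fun g h v => by
        simp only [hr, _root_.map_mul, mul_smul]
        rw [mul_assoc, mul_assoc, mul_assoc, mul_assoc, mul_assoc, inv_mul_cancel_left]⟩
    have hr1 : ∀ v, r (s v) o = ⟨s o, hsN⟩ := fun v => by
      apply Subtype.ext
      simp only [r, hso]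
      group
    have hr2 : ∀ n : N, r n o = ⟨s o, hsN⟩⁻¹ * n * ⟨s o, hsN⟩ := fun n => by
      apply Subtype.ext
      simp only [r, hn, Subgroup.coe_mul, Subgroup.coe_inv]
      group
    refine ⟨⟨d, f o * (ψ ⟨s o, hsN⟩)⁻¹⟩, Prod.ext ?_ ?_⟩
    · ext n
      change f ((n : G) • o) * ψ (r n o) * (f o)⁻¹ = ψ n
      rw [hn, hr2, _root_.map_mul, _root_.map_mul, _root_.map_inv, mul_right_comm, mul_inv_cancel,
        one_mul, mul_right_comm, inv_mul_cancel, one_mul]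
    · funext v
      change f (s v • o) * ψ (r (s v) o) * (f o)⁻¹ * (f o * (ψ ⟨s o, hsN⟩)⁻¹) = f v
      rw [hso, hr1]
      group

end ActionCocycle

theorem MonoidHom.restrict_injective_of_closure_eq_top {G A : Type*} [Group G] [Group A]
    {S : Finset G} (hS : Subgroup.closure (S : Set G) = ⊤) :
    Function.Injective (fun (f : G →* A) (x : S) => f x) := fun _ _ h =>
  MonoidHom.eq_of_eqOn_dense hS fun x hx => congrFun h ⟨x, hx⟩

/-- The rank of a finitely generated free group, counted by its characters of order two. -/
theorem IsFreeGroup.card_hom_eq_two_pow_rank (G : Type*) [Group G] [IsFreeGroup G] [Group.FG G] :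
    Nat.card (G →* Multiplicative (ZMod 2)) = 2 ^ Group.rank G := by
  classical
  let A := Multiplicative (ZMod 2)
  have hA : Nat.card A = 2 := Nat.card_zmod 2
  have : Finite A := inferInstanceAs (Finite (ZMod 2))
  have : Nontrivial A := inferInstanceAs (Nontrivial (ZMod 2))
  obtain ⟨S, hS, hS'⟩ := Group.rank_spec G
  have hinj := MonoidHom.restrict_injective_of_closure_eq_top (A := A) hS'
  have hfin : Finite (G →* A) := Finite.of_injective _ hinj
  have e := IsFreeGroup.lift (G := G) (H := A)
  have : Finite (IsFreeGroup.Generators G → A) := Finite.of_equiv _ e.symm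
  obtain ⟨z, hz⟩ := exists_ne (1 : A)
  have : Finite (IsFreeGroup.Generators G) :=
    Finite.of_injective (fun i => (Pi.mulSingle i z : IsFreeGroup.Generators G → A))
      fun i j h => by
        by_contra hij
        have := congrFun h i
        simp [Pi.mulSingle_eq_of_ne hij, hz] at this
  have hcard : Nat.card (G →* A) = 2 ^ Nat.card (IsFreeGroup.Generators G) := by
    rw [← Nat.card_congr e, Nat.card_fun, hA]
  refine le_antisymm ?_ ?_
  · calc Nat.card (G →* A) ≤ Nat.card (S → A) := Nat.card_le_card_of_injective _ hinj
      _ = 2 ^ Group.rank G := by rw [Nat.card_fun, hA, ← hS]; simp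
  · change _ ≤ Nat.card (G →* A)
    rw [hcard]
    refine Nat.pow_le_pow_right two_pos ?_
    have : Fintype (IsFreeGroup.Generators G) := Fintype.ofFinite _
    have hT : Subgroup.closure ((Finset.univ.image FreeGroup.of :
        Finset (FreeGroup (IsFreeGroup.Generators G))) :
          Set (FreeGroup (IsFreeGroup.Generators G))) = ⊤ := by
      rw [Finset.coe_image, Finset.coe_univ, Set.image_univ, FreeGroup.closure_range_of]
    have : Group.FG (FreeGroup (IsFreeGroup.Generators G)) := Group.fg_iff'.2 ⟨_, _, rfl, hT⟩
    rw [Group.rank_congr (IsFreeGroup.toFreeGroup G), Nat.card_eq_fintype_card]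
    exact (Group.rank_le hT).trans Finset.card_image_le

/-- The Schreier index formula. -/
theorem FreeGroup.rank_add_index {X : Type*} [Finite X] (N : Subgroup (FreeGroup X))
    [N.FiniteIndex] [Group.FG N] :
    Group.rank N + N.index = Nat.card X * N.index + 1 := by
  obtain ⟨e⟩ := ActionCocycle.nonempty_equiv_hom (A := Multiplicative (ZMod 2)) N
  have h1 := Nat.card_congr e
  have h2 := Nat.card_eq_of_bijective _
    (ActionCocycle.restrict_bijective (X := X) (V := FreeGroup X ⧸ N)
      (A := Multiplicative (ZMod 2)))
  have hA : Nat.card (Multiplicative (ZMod 2)) = 2 := Nat.card_zmod 2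
  rw [Nat.card_prod, Nat.card_prod, h2, IsFreeGroup.card_hom_eq_two_pow_rank, Nat.card_fun,
    Nat.card_fun, hA, ← pow_mul, ← pow_succ, ← pow_add] at h1
  have h3 := Nat.pow_right_injective le_rfl h1
  rw [mul_comm]
  exact h3.symm

/-- The exponent sum of the generator `c`, modulo `p`. -/
def FreeGroup.exponentMod (c : Bool) (p : ℕ) : FreeGroup Bool →* Multiplicative (ZMod p) :=
  FreeGroup.lift fun t => if t = c then Multiplicative.ofAdd 1 else 1

theorem FreeGroup.exponentMod_of_zpow (c : Bool) (p : ℕ) (k : ℤ) :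
    FreeGroup.exponentMod c p (FreeGroup.of c ^ k) = Multiplicative.ofAdd (k : ZMod p) := by
  rw [map_zpow, FreeGroup.exponentMod, FreeGroup.lift_apply_of, if_pos rfl, ← ofAdd_zsmul]
  simp

theorem FreeGroup.closure_conj_eq_ker (c : Bool) (p : ℕ) (hp : 0 < p) :
    Subgroup.closure ((fun i : ℕ => FreeGroup.of c ^ i * FreeGroup.of (!c) *
      (FreeGroup.of c ^ i)⁻¹) '' Set.Iio p ∪ {FreeGroup.of c ^ p}) =
      (FreeGroup.exponentMod c p).ker := by
  set x : FreeGroup Bool := FreeGroup.of c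
  set y : FreeGroup Bool := FreeGroup.of (!c)
  have hpow : ∀ k : ℤ, FreeGroup.exponentMod c p (x ^ k) = Multiplicative.ofAdd (k : ZMod p) :=
    FreeGroup.exponentMod_of_zpow c p
  have hy : FreeGroup.exponentMod c p y = 1 := by simp [FreeGroup.exponentMod, y]
  set H := Subgroup.closure ((fun i : ℕ => x ^ i * y * (x ^ i)⁻¹) '' Set.Iio p ∪ {x ^ p})
  have hle : H ≤ (FreeGroup.exponentMod c p).ker := by
    rw [Subgroup.closure_le]
    rintro _ (⟨i, -, rfl⟩ | rfl)
    · simp [MonoidHom.mem_ker, hy]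
    · have := hpow p
      simpa [MonoidHom.mem_ker] using this
  refine le_antisymm hle ?_
  have hx : ∀ q : ℤ, x ^ ((p : ℤ) * q) ∈ H := fun q => by
    rw [zpow_mul, zpow_natCast]
    exact H.zpow_mem (Subgroup.subset_closure (Or.inr rfl)) q
  have hyk : ∀ k : ℤ, x ^ k * y * (x ^ k)⁻¹ ∈ H := fun k => by
    have hr0 : 0 ≤ k % p := Int.emod_nonneg _ (by omega)
    have hr1 : k % p < p := Int.emod_lt_of_pos _ (by omega)
    obtain ⟨r, hr⟩ := Int.eq_ofNat_of_zero_le hr0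
    have hrH : x ^ r * y * (x ^ r)⁻¹ ∈ H :=
      Subgroup.subset_closure (Or.inl ⟨r, by simp only [Set.mem_Iio]; omega, rfl⟩)
    have hk : x ^ k = x ^ ((p : ℤ) * (k / p)) * x ^ r := by
      rw [← zpow_natCast x r, ← zpow_add]
      congr 1
      rw [← hr, Int.mul_ediv_add_emod]
    have := H.mul_mem (H.mul_mem (hx (k / p)) hrH) (H.inv_mem (hx (k / p)))
    rw [hk]
    convert this using 1
    group
  have key : ∀ g : FreeGroup Bool, ∃ e : ℤ, ∀ k : ℤ, x ^ k * g * (x ^ (k + e))⁻¹ ∈ H := by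
    intro g
    induction g using FreeGroup.induction_on with
    | C1 => exact ⟨0, fun k => by simp⟩
    | of t =>
      by_cases ht : t = c
      · subst ht
        refine ⟨1, fun k => ?_⟩
        simp [zpow_add, x]
      · obtain rfl : t = !c := by cases t <;> cases c <;> simp_all
        exact ⟨0, fun k => by simpa using hyk k⟩
    | inv_of t ih =>
      obtain ⟨e, he⟩ := ih
      refine ⟨-e, fun k => ?_⟩
      have := H.inv_mem (he (k + -e))
      convert this using 1
      group
    | mul g h hg hh =>
      obtain ⟨e, he⟩ := hg
      obtain ⟨f, hf⟩ := hh
      refine ⟨e + f, fun k => ?_⟩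
      have := H.mul_mem (he k) (hf (k + e))
      convert this using 1
      group
  intro g hg
  obtain ⟨e, he⟩ := key g
  have h0 := he 0
  rw [zpow_zero, one_mul, zero_add] at h0
  have h1 := hle h0
  rw [MonoidHom.mem_ker, _root_.map_mul, MonoidHom.mem_ker.1 hg, one_mul, _root_.map_inv,
    inv_eq_one, hpow, ofAdd_eq_one, ZMod.intCast_zmod_eq_zero_iff_dvd] at h1
  obtain ⟨q, rfl⟩ := h1
  simpa using H.mul_mem h0 (hx q)

theorem FreeGroup.index_ker_exponentMod (c : Bool) (p : ℕ) :
    (FreeGroup.exponentMod c p).ker.index = p := by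
  have hs : Function.Surjective (FreeGroup.exponentMod c p) := fun z => by
    obtain ⟨k, hk⟩ := ZMod.intCast_surjective z.toAdd
    exact ⟨_, (FreeGroup.exponentMod_of_zpow c p k).trans (by rw [hk]; rfl)⟩
  rw [Subgroup.index_ker, MonoidHom.range_eq_top.2 hs, Subgroup.card_top]
  exact Nat.card_zmod p

theorem FreeGroup.index_ker_inf_ker_exponentMod (c : Bool) (p q : ℕ) :
    ((FreeGroup.exponentMod c p).ker ⊓ (FreeGroup.exponentMod (!c) q).ker).index = p * q := by
  have hs : Function.Surjective
      ((FreeGroup.exponentMod c p).prod (FreeGroup.exponentMod (!c) q)) := by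
    rintro ⟨z, w⟩
    obtain ⟨k, hk⟩ := ZMod.intCast_surjective z.toAdd
    obtain ⟨l, hl⟩ := ZMod.intCast_surjective w.toAdd
    refine ⟨FreeGroup.of c ^ k * FreeGroup.of (!c) ^ l, Prod.ext ?_ ?_⟩
    · have := FreeGroup.exponentMod_of_zpow c p k
      rw [hk] at this
      simpa [FreeGroup.exponentMod] using this
    · have := FreeGroup.exponentMod_of_zpow (!c) q l
      rw [hl] at this
      simpa [FreeGroup.exponentMod] using this
  rw [← MonoidHom.ker_prod, Subgroup.index_ker, MonoidHom.range_eq_top.2 hs, Subgroup.card_top,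
    Nat.card_prod]
  congr 1
  · exact Nat.card_zmod p
  · exact Nat.card_zmod q

theorem FreeGroup.exists_rank_of_index_eq (N : Subgroup (FreeGroup Bool)) {k : ℕ} (hk : k ≠ 0)
    (hN : N.index = k) : ∃ h : Group.FG N, @Group.rank N _ h = k + 1 := by
  have : N.FiniteIndex := ⟨hN ▸ hk⟩
  have hFG : Group.FG N := N.fg_of_index_ne_zero
  refine ⟨hFG, ?_⟩
  have := FreeGroup.rank_add_index N
  rw [hN, Nat.card_eq_fintype_card, Fintype.card_bool] at this
  omega

theorem stmt_1 (m n : ℕ) (hm : 2 ≤ m) (hn : 2 ≤ n) :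
    let a : FreeGroup Bool := FreeGroup.of true
    let b : FreeGroup Bool := FreeGroup.of false
    let H : Subgroup (FreeGroup Bool) :=
      Subgroup.closure ((fun i : ℕ => b ^ i * a * (b ^ i)⁻¹) '' Set.Iio (m - 1) ∪ {b ^ (m - 1)})
    let K : Subgroup (FreeGroup Bool) :=
      Subgroup.closure ((fun i : ℕ => a ^ i * b * (a ^ i)⁻¹) '' Set.Iio (n - 1) ∪ {a ^ (n - 1)})
    (∃ hH : Group.FG ↥H, @Group.rank ↥H _ hH = m) ∧
    (∃ hK : Group.FG ↥K, @Group.rank ↥K _ hK = n) ∧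
    (∃ hI : Group.FG ↥(H ⊓ K), @Group.rank ↥(H ⊓ K) _ hI - 1 = (m - 1) * (n - 1)) := by
  intro a b H K
  have hH : H = (FreeGroup.exponentMod false (m - 1)).ker :=
    FreeGroup.closure_conj_eq_ker false (m - 1) (by omega)
  have hK : K = (FreeGroup.exponentMod true (n - 1)).ker :=
    FreeGroup.closure_conj_eq_ker true (n - 1) (by omega)
  have hm0 : m - 1 ≠ 0 := by omega
  have hn0 : n - 1 ≠ 0 := by omega
  obtain ⟨h1, e1⟩ := FreeGroup.exists_rank_of_index_eq H hm0
    (by rw [hH, FreeGroup.index_ker_exponentMod])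
  obtain ⟨h2, e2⟩ := FreeGroup.exists_rank_of_index_eq K hn0
    (by rw [hK, FreeGroup.index_ker_exponentMod])
  obtain ⟨h3, e3⟩ := FreeGroup.exists_rank_of_index_eq (H ⊓ K) (mul_ne_zero hm0 hn0)
    (by rw [hH, hK]; exact FreeGroup.index_ker_inf_ker_exponentMod false _ _)
  exact ⟨⟨h1, by omega⟩, ⟨h2, by omega⟩, ⟨h3, by rw [e3, Nat.add_sub_cancel]⟩⟩
end

section
/- Let F be a free group and let m, n ≥ 2 and N be natural numbers with 1 ≤ N - 1 ≤ (m-1)(n-1). If F has rank at least 2, then there exist finitely generated subgroups H, K ≤ F of ranks m and n respectively such that the rank of H ∩ K equals N. -/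
/-- A directed multigraph with vertices `V` and edges `E` labelled by `X`. -/
structure LabeledGraph (X V E : Type*) where
  src : E → V
  tgt : E → V
  lab : E → X

namespace LabeledGraph

variable {X V E : Type*} (Γ : LabeledGraph X V E)

/-- The initial vertex of an oriented edge; `(e, false)` is `e` traversed backwards. -/
def ini (a : E × Bool) : V := bif a.2 then Γ.src a.1 else Γ.tgt a.1

@[simp] lemma ini_true (e : E) : Γ.ini (e, true) = Γ.src e := rfl

@[simp] lemma ini_false (e : E) : Γ.ini (e, false) = Γ.tgt e := rfl

/-- A list of oriented edges is a walk between two given vertices. -/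
def IsWalk : V → List (E × Bool) → V → Prop
  | u, [], v => u = v
  | u, a :: w, v => Γ.ini a = u ∧ IsWalk (Γ.ini (a.1, !a.2)) w v

@[simp] lemma isWalk_nil {u v : V} : Γ.IsWalk u [] v ↔ u = v := Iff.rfl

@[simp] lemma isWalk_cons {u v : V} {a : E × Bool} {w : List (E × Bool)} :
    Γ.IsWalk u (a :: w) v ↔ Γ.ini a = u ∧ Γ.IsWalk (Γ.ini (a.1, !a.2)) w v := Iff.rfl

variable {Γ}

lemma isWalk_append {u v : V} {w w' : List (E × Bool)} :
    Γ.IsWalk u (w ++ w') v ↔ ∃ t, Γ.IsWalk u w t ∧ Γ.IsWalk t w' v := by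
  induction w generalizing u with
  | nil => simp
  | cons a w ih => simp [ih, and_assoc]

lemma IsWalk.append {u t v : V} {w w' : List (E × Bool)} (h : Γ.IsWalk u w t)
    (h' : Γ.IsWalk t w' v) : Γ.IsWalk u (w ++ w') v :=
  isWalk_append.2 ⟨t, h, h'⟩

lemma IsWalk.invRev {u v : V} {w : List (E × Bool)} (h : Γ.IsWalk u w v) :
    Γ.IsWalk v (FreeGroup.invRev w) u := by
  induction w generalizing u with
  | nil => exact h.symm
  | cons a w ih =>
    rw [FreeGroup.invRev_cons]
    exact (ih h.2).append (by simpa [FreeGroup.invRev] using h.1)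

lemma IsWalk.step {u v : V} {w w' : List (E × Bool)} (h : Γ.IsWalk u w v)
    (hw : FreeGroup.Red.Step w w') : Γ.IsWalk u w' v := by
  obtain ⟨⟩ := hw
  simp only [isWalk_append, isWalk_cons, Bool.not_not] at h ⊢
  obtain ⟨t, h₁, rfl, -, h₂⟩ := h
  exact ⟨_, h₁, h₂⟩

lemma IsWalk.red {u v : V} {w w' : List (E × Bool)} (h : Γ.IsWalk u w v)
    (hw : FreeGroup.Red w w') : Γ.IsWalk u w' v := by
  induction hw with
  | refl => exact h
  | tail _ hs ih => exact ih.step hs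

variable (Γ)

/-- The classes of closed walks at `v`, as a subgroup of the free group on the edges. -/
def loops (v : V) : Subgroup (FreeGroup E) where
  carrier := {g | ∃ w, Γ.IsWalk v w v ∧ FreeGroup.mk w = g}
  mul_mem' := by
    rintro _ _ ⟨w, hw, rfl⟩ ⟨w', hw', rfl⟩
    exact ⟨w ++ w', hw.append hw', FreeGroup.mul_mk.symm⟩
  one_mem' := ⟨[], rfl, rfl⟩
  inv_mem' := by
    rintro _ ⟨w, hw, rfl⟩
    exact ⟨_, hw.invRev, FreeGroup.inv_mk.symm⟩

/-- Reading off the labels of a closed walk. -/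
def readLoops (v : V) : Γ.loops v →* FreeGroup X :=
  (FreeGroup.map Γ.lab).comp (Γ.loops v).subtype

/-- The subgroup of all elements spelled by closed walks at `v`. -/
def labelGroup (v : V) : Subgroup (FreeGroup X) := (Γ.readLoops v).range

/-- No two edges with the same label share their source or their target. -/
def Folded : Prop :=
  ∀ b e e', Γ.lab e = Γ.lab e' → Γ.ini (e, b) = Γ.ini (e', b) → e = e'

/-- A set of vertices closed under adjacency that contains `v` contains every vertex. -/
def ConnectedFrom (v : V) : Prop :=
  ∀ S : Set V, v ∈ S → (∀ e, Γ.src e ∈ S ↔ Γ.tgt e ∈ S) → ∀ u, u ∈ S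

/-- The word spelled by a list of oriented edges. -/
def word (w : List (E × Bool)) : List (X × Bool) := w.map fun a => (Γ.lab a.1, a.2)

variable {Γ}

open scoped Classical in
lemma isWalk_toWord {v : V} {g : FreeGroup E} (hg : g ∈ Γ.loops v) :
    Γ.IsWalk v g.toWord v := by
  obtain ⟨w, hw, rfl⟩ := hg
  rw [FreeGroup.toWord_mk]
  exact hw.red FreeGroup.reduce.red

lemma Folded.isReduced_word (hΓ : Γ.Folded) {u v : V} {w : List (E × Bool)}
    (h : Γ.IsWalk u w v) (hw : FreeGroup.IsReduced w) : FreeGroup.IsReduced (Γ.word w) := by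
  induction w generalizing u with
  | nil => exact FreeGroup.IsReduced.nil
  | cons a w ih =>
    cases w with
    | nil => exact FreeGroup.IsReduced.singleton
    | cons a' w =>
      obtain ⟨e, b⟩ := a
      obtain ⟨e', b'⟩ := a'
      rw [FreeGroup.isReduced_cons_cons] at hw
      have ih' := ih h.2 hw.2
      simp only [word, List.map_cons] at ih' ⊢
      rw [FreeGroup.isReduced_cons_cons]
      refine ⟨fun hl => ?_, ih'⟩
      by_contra hb
      obtain rfl : b' = !b := by cases b <;> cases b' <;> simp_all
      exact hb (hw.1 (hΓ _ _ _ hl h.2.1.symm))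

open scoped Classical in
lemma Folded.toWord_map (hΓ : Γ.Folded) {v : V} {g : FreeGroup E} (hg : g ∈ Γ.loops v) :
    (FreeGroup.map Γ.lab g).toWord = Γ.word g.toWord := by
  conv_lhs => rw [← FreeGroup.mk_toWord (x := g)]
  rw [FreeGroup.map.mk, FreeGroup.toWord_mk]
  exact (hΓ.isReduced_word (isWalk_toWord hg) FreeGroup.isReduced_toWord).reduce_eq

lemma Folded.readLoops_injective (hΓ : Γ.Folded) (v : V) :
    Function.Injective (Γ.readLoops v) := by
  classical
  refine (injective_iff_map_eq_one _).2 fun ⟨g, hg⟩ h => ?_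
  have h' := hΓ.toWord_map hg
  have h1 : FreeGroup.map Γ.lab g = 1 := h
  rw [h1, FreeGroup.toWord_one] at h'
  exact Subtype.ext (FreeGroup.toWord_eq_nil_iff.1 (List.map_eq_nil_iff.1 h'.symm))

/-! ### The rank of the group of loops -/

lemma closure_eq_loops {v : V} {τ : V → FreeGroup E} {T : Set E}
    (hτ : ∀ u, ∃ w, Γ.IsWalk v w u ∧ FreeGroup.mk w = τ u) (hv : τ v = 1)
    (hT : ∀ e ∈ T, τ (Γ.src e) * FreeGroup.of e * (τ (Γ.tgt e))⁻¹ = 1) :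
    Subgroup.closure ((fun e => τ (Γ.src e) * FreeGroup.of e * (τ (Γ.tgt e))⁻¹) '' Tᶜ) =
      Γ.loops v := by
  set f := fun e => τ (Γ.src e) * FreeGroup.of e * (τ (Γ.tgt e))⁻¹ with hf
  have hmem : ∀ e, f e ∈ Subgroup.closure (f '' Tᶜ) := fun e => by
    by_cases he : e ∈ T
    · rw [hf]
      simp only
      rw [hT e he]
      exact one_mem _
    · exact Subgroup.subset_closure ⟨e, he, rfl⟩
  apply le_antisymm
  · rw [Subgroup.closure_le]
    rintro _ ⟨e, -, rfl⟩
    obtain ⟨w, hw, hw'⟩ := hτ (Γ.src e)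
    obtain ⟨w₂, hw₂, hw₂'⟩ := hτ (Γ.tgt e)
    refine ⟨w ++ [(e, true)] ++ FreeGroup.invRev w₂, (hw.append ?_).append hw₂.invRev, ?_⟩
    · simp
    · rw [← FreeGroup.mul_mk, ← FreeGroup.mul_mk, ← FreeGroup.inv_mk, hw', hw₂']
      rfl
  · have key : ∀ w u u', Γ.IsWalk u w u' →
        τ u * FreeGroup.mk w * (τ u')⁻¹ ∈ Subgroup.closure (f '' Tᶜ) := by
      intro w
      induction w with
      | nil =>
        rintro u _ rfl
        rw [← FreeGroup.one_eq_mk]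
        simp
      | cons a w ih =>
        rintro _ u' ⟨rfl, h⟩
        have h1 := ih _ _ h
        have h2 : FreeGroup.mk (a :: w) = FreeGroup.mk [a] * FreeGroup.mk w := by
          rw [FreeGroup.mul_mk]; rfl
        obtain ⟨e, b⟩ := a
        have h3 : τ (Γ.ini (e, b)) * FreeGroup.mk [(e, b)] * (τ (Γ.ini (e, !b)))⁻¹ ∈
            Subgroup.closure (f '' Tᶜ) := by
          cases b with
          | true => exact hmem e
          | false =>
            have h4 := inv_mem (hmem e)
            have h5 : FreeGroup.mk [(e, false)] = (FreeGroup.of e)⁻¹ := rfl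
            rw [h5]
            simpa [hf, mul_assoc] using h4
        have h6 := mul_mem h3 h1
        rw [h2]
        convert! h6 using 1
        group
    rintro _ ⟨w, hw, rfl⟩
    simpa [hv] using key w v v hw

/-- The data of a spanning tree `T` on the vertex set `S`, with `τ` recording the tree paths. -/
def IsTreeOn (Γ : LabeledGraph X V E) (v : V) (S : Finset V) (T : Finset E)
    (τ : V → FreeGroup E) : Prop :=
  v ∈ S ∧ T.card + 1 = S.card ∧ τ v = 1 ∧
    (∀ u ∈ S, (∃ w, Γ.IsWalk v w u ∧ FreeGroup.mk w = τ u) ∧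
      τ u ∈ Subgroup.closure (FreeGroup.of '' (T : Set E))) ∧
    ∀ e ∈ T, Γ.src e ∈ S ∧ Γ.tgt e ∈ S ∧
      τ (Γ.src e) * FreeGroup.of e * (τ (Γ.tgt e))⁻¹ = 1

lemma IsTreeOn.extend {v : V} {S : Finset V} {T : Finset E} {τ : V → FreeGroup E}
    (h : Γ.IsTreeOn v S T τ) {e : E} {b : Bool} (h₁ : Γ.ini (e, b) ∈ S)
    (h₂ : Γ.ini (e, !b) ∉ S) : ∃ S' T' τ', Γ.IsTreeOn v S' T' τ' ∧ S.card < S'.card := by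
  classical
  obtain ⟨hv, hc, hτ, hS, hT⟩ := h
  set t := Γ.ini (e, !b) with ht
  have ne : ∀ u ∈ S, u ≠ t := fun u hu h => h₂ (h ▸ hu)
  have heT : e ∉ T := fun he => h₂ (by
    rw [ht]; cases b
    · exact (hT e he).1
    · exact (hT e he).2.1)
  refine ⟨insert t S, insert e T,
    Function.update τ t (τ (Γ.ini (e, b)) * FreeGroup.mk [(e, b)]), ⟨?_, ?_, ?_, ?_, ?_⟩, ?_⟩
  · exact Finset.mem_insert_of_mem hv
  · rw [Finset.card_insert_of_notMem heT, Finset.card_insert_of_notMem h₂, hc]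
  · rw [Function.update_of_ne (ne v hv), hτ]
  · have mono : Subgroup.closure (FreeGroup.of '' (T : Set E)) ≤
        Subgroup.closure (FreeGroup.of '' ((insert e T : Finset E) : Set E)) :=
      Subgroup.closure_mono (Set.image_mono (by simp))
    intro u hu
    rcases Finset.mem_insert.1 hu with rfl | hu
    · rw [Function.update_self]
      obtain ⟨⟨w, hw, hw'⟩, hcl⟩ := hS _ h₁
      refine ⟨⟨w ++ [(e, b)], hw.append (by simp [ht]), ?_⟩, mul_mem (mono hcl) ?_⟩
      · rw [← FreeGroup.mul_mk, hw']
      · have : FreeGroup.of e ∈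
            Subgroup.closure (FreeGroup.of '' ((insert e T : Finset E) : Set E)) :=
          Subgroup.subset_closure ⟨e, by simp, rfl⟩
        cases b
        · exact inv_mem this
        · exact this
    · rw [Function.update_of_ne (ne u hu)]
      exact ⟨(hS u hu).1, mono (hS u hu).2⟩
  · intro e' he'
    rcases Finset.mem_insert.1 he' with rfl | he'
    · cases b
      · have h₁' : Γ.tgt e' ∈ S := h₁
        have ht' : t = Γ.src e' := ht
        have h5 : FreeGroup.mk [(e', false)] = (FreeGroup.of e')⁻¹ := rfl
        refine ⟨by simp [ht'], by simp [h₁'], ?_⟩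
        rw [← ht', Function.update_self, Function.update_of_ne (ne _ h₁'), h5]
        simp
      · have h₁' : Γ.src e' ∈ S := h₁
        have ht' : t = Γ.tgt e' := ht
        have h5 : FreeGroup.mk [(e', true)] = FreeGroup.of e' := rfl
        refine ⟨by simp [h₁'], by simp [ht'], ?_⟩
        rw [← ht', Function.update_self, Function.update_of_ne (ne _ h₁'), h5]
        simp
    · obtain ⟨hs, htg, hl⟩ := hT e' he'
      refine ⟨Finset.mem_insert_of_mem hs, Finset.mem_insert_of_mem htg, ?_⟩
      rw [Function.update_of_ne (ne _ hs), Function.update_of_ne (ne _ htg), hl]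
  · rw [Finset.card_insert_of_notMem h₂]
    exact Nat.lt_succ_self _

lemma ConnectedFrom.exists_isTreeOn [Fintype V] {v : V} (hv : Γ.ConnectedFrom v) :
    ∃ T τ, Γ.IsTreeOn v Finset.univ T τ := by
  classical
  have hex : ∃ k, ∃ S T τ, Γ.IsTreeOn v S T τ ∧ Fintype.card V - S.card = k :=
    ⟨_, {v}, ∅, fun _ => 1, ⟨by simp, by simp, rfl, by
      simp only [Finset.mem_singleton, forall_eq]
      exact ⟨⟨[], rfl, rfl⟩, one_mem _⟩, by simp⟩, rfl⟩
  obtain ⟨S, T, τ, h, hk⟩ := Nat.find_spec hex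
  have hmin : ¬ ∃ S' T' τ', Γ.IsTreeOn v S' T' τ' ∧ S.card < S'.card := by
    rintro ⟨S', T', τ', h', hlt⟩
    have := Nat.find_min' hex ⟨S', T', τ', h', rfl⟩
    have := S'.card_le_univ
    omega
  have hS : S = Finset.univ := by
    refine Finset.eq_univ_iff_forall.2 (hv S h.1 fun e => ?_)
    by_contra hne
    have hiff := not_iff.1 hne
    by_cases hs : Γ.src e ∈ S
    · exact hmin (h.extend (b := true) hs fun ht => (hiff.2 ht) hs)
    · exact hmin (h.extend (b := false) (hiff.1 hs) hs)
  subst hS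
  exact ⟨T, τ, h⟩

lemma card_le_rank_of_surjective {G T : Type*} [Group G] [Group.FG G] [Finite T]
    {f : G →* Multiplicative (T → ZMod 2)} (hf : Function.Surjective f) :
    Nat.card T ≤ Group.rank G := by
  have : Group.FG (Multiplicative (T → ZMod 2)) := Group.fg_of_surjective hf
  refine le_trans ?_ (Group.rank_le_of_surjective f hf)
  have h := card_dvd_exponent_pow_rank' (Multiplicative (T → ZMod 2)) (n := 2) fun g => by
    apply Multiplicative.toAdd.injective
    funext i
    simp [CharTwo.two_eq_zero]
  rw [show Nat.card (Multiplicative (T → ZMod 2)) = 2 ^ Nat.card T by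
    rw [Nat.card_congr Multiplicative.toAdd, Nat.card_fun]; simp] at h
  exact (Nat.pow_dvd_pow_iff_le_right (by norm_num)).1 h

theorem ConnectedFrom.rank_loops [Fintype V] [Fintype E] {v : V} (hv : Γ.ConnectedFrom v) :
    ∃ _ : Group.FG (Γ.loops v),
      Group.rank (Γ.loops v) + Fintype.card V = Fintype.card E + 1 := by
  classical
  obtain ⟨T, τ, -, hc, hτ, hS, hT⟩ := hv.exists_isTreeOn
  have hT' := fun e he => (hT e he).2.2
  have hcl := closure_eq_loops (T := (T : Set E)) (fun u => (hS u (Finset.mem_univ u)).1) hτ hT'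
  set f := fun e => τ (Γ.src e) * FreeGroup.of e * (τ (Γ.tgt e))⁻¹ with hf
  have hcl' : Subgroup.closure (((Tᶜ).image f : Finset (FreeGroup E)) : Set (FreeGroup E)) =
      Γ.loops v := by
    rw [← hcl]
    congr 1
    simp
  have hfg : Group.FG (Γ.loops v) := by
    rw [← hcl']
    infer_instance
  refine ⟨hfg, ?_⟩
  have hle : Group.rank (Γ.loops v) ≤ (Tᶜ).card := by
    rw [← Subgroup.rank_congr hcl']
    exact (Subgroup.rank_closure_finset_le_card _).trans Finset.card_image_le
  have hge : (Tᶜ).card ≤ Group.rank (Γ.loops v) := by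
    let ψ : FreeGroup E →* Multiplicative ((Tᶜ : Finset E) → ZMod 2) :=
      FreeGroup.lift fun e => Multiplicative.ofAdd fun t => if (t : E) = e then 1 else 0
    have hψ : ∀ u, ψ (τ u) = 1 := fun u => by
      have : Subgroup.closure (FreeGroup.of '' (T : Set E)) ≤ ψ.ker := by
        rw [Subgroup.closure_le]
        rintro _ ⟨e, he, rfl⟩
        change ψ _ = 1
        rw [FreeGroup.lift_apply_of]
        apply Multiplicative.toAdd.injective
        funext ⟨t, ht⟩
        have hne : t ≠ e := by rintro rfl; exact (Finset.mem_compl.1 ht) he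
        simp [hne]
      exact this (hS u (Finset.mem_univ u)).2
    have hmem : ∀ e ∉ T, f e ∈ Γ.loops v := fun e he => by
      rw [← hcl]
      exact Subgroup.subset_closure ⟨e, he, rfl⟩
    have hsurj : Function.Surjective (ψ.comp (Γ.loops v).subtype) := by
      rw [← MonoidHom.range_eq_top, eq_top_iff]
      intro x _
      have hx : x = ∏ i, Multiplicative.ofAdd (Pi.single i (1 : ZMod 2) : _ → ZMod 2) ^
          (x.toAdd i).val := by
        apply Multiplicative.toAdd.injective
        funext j
        simp only [toAdd_prod, toAdd_pow, toAdd_ofAdd, Finset.sum_apply, Pi.smul_apply]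
        simp only [Pi.single_apply, nsmul_eq_mul, ZMod.natCast_zmod_val, mul_ite, mul_one, mul_zero,
          Finset.sum_ite_eq, Finset.mem_univ, if_true]
      rw [hx]
      refine prod_mem fun ⟨e, he⟩ _ => pow_mem
        (MonoidHom.mem_range.2 ⟨⟨f e, hmem e (Finset.mem_compl.1 he)⟩, ?_⟩) _
      change ψ (f e) = _
      rw [hf]
      simp only [map_mul, map_inv, hψ, ψ, FreeGroup.lift_apply_of]
      apply Multiplicative.toAdd.injective
      funext j
      simp [Pi.single_apply, Subtype.ext_iff]
    simpa only [Nat.card_eq_fintype_card, Fintype.card_coe] using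
      card_le_rank_of_surjective hsurj
  have := Finset.card_add_card_compl T
  rw [Finset.card_univ] at hc
  omega

/-- The subgroup `H` is finitely generated of rank `n`. -/
def _root_.Subgroup.HasRank {G : Type*} [Group G] (H : Subgroup G) (n : ℕ) : Prop :=
  ∃ _ : Group.FG H, Group.rank H = n

theorem ConnectedFrom.hasRank_labelGroup [Fintype V] [Fintype E] {v : V}
    (hv : Γ.ConnectedFrom v) (hΓ : Γ.Folded) {n : ℕ}
    (hn : n + Fintype.card V = Fintype.card E + 1) : (Γ.labelGroup v).HasRank n := by
  obtain ⟨hfg, h⟩ := hv.rank_loops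
  let e : Γ.loops v ≃* Γ.labelGroup v := MonoidHom.ofInjective (hΓ.readLoops_injective v)
  have : Group.FG (Γ.labelGroup v) := Group.fg_of_surjective (f := e.toMonoidHom) e.surjective
  exact ⟨this, by rw [← Group.rank_congr e]; omega⟩

/-! ### Intersections as fibre products -/

lemma mem_labelGroup {v : V} {x : FreeGroup X} :
    x ∈ Γ.labelGroup v ↔ ∃ w, Γ.IsWalk v w v ∧ FreeGroup.mk (Γ.word w) = x := by
  constructor
  · rintro ⟨⟨_, w, hw, rfl⟩, rfl⟩
    exact ⟨w, hw, FreeGroup.map.mk.symm⟩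
  · rintro ⟨w, hw, rfl⟩
    exact ⟨⟨_, w, hw, rfl⟩, FreeGroup.map.mk⟩

open scoped Classical in
lemma Folded.exists_word_eq_toWord (hΓ : Γ.Folded) {v : V} {x : FreeGroup X}
    (hx : x ∈ Γ.labelGroup v) : ∃ w, Γ.IsWalk v w v ∧ Γ.word w = x.toWord := by
  obtain ⟨⟨g, hg⟩, rfl⟩ := hx
  exact ⟨g.toWord, isWalk_toWord hg, (hΓ.toWord_map hg).symm⟩

/-- A label-preserving morphism of graphs. -/
structure Hom {V' E' : Type*} (Γ : LabeledGraph X V E) (Γ' : LabeledGraph X V' E') where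
  onV : V → V'
  onE : E → E'
  src_onE : ∀ e, Γ'.src (onE e) = onV (Γ.src e)
  tgt_onE : ∀ e, Γ'.tgt (onE e) = onV (Γ.tgt e)
  lab_onE : ∀ e, Γ'.lab (onE e) = Γ.lab e

section Hom

variable {V' E' : Type*} {Γ' : LabeledGraph X V' E'}

lemma Hom.ini_onE (φ : Hom Γ Γ') (e : E) (b : Bool) :
    Γ'.ini (φ.onE e, b) = φ.onV (Γ.ini (e, b)) := by
  cases b
  · exact φ.tgt_onE e
  · exact φ.src_onE e

lemma IsWalk.map (φ : Hom Γ Γ') {u v : V} {w : List (E × Bool)} (h : Γ.IsWalk u w v) :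
    Γ'.IsWalk (φ.onV u) (w.map fun a => (φ.onE a.1, a.2)) (φ.onV v) := by
  induction w generalizing u with
  | nil => exact congrArg _ h
  | cons a w ih =>
    obtain ⟨rfl, h⟩ := h
    refine ⟨φ.ini_onE _ _, ?_⟩
    rw [φ.ini_onE]
    exact ih h

lemma labelGroup_le (φ : Hom Γ Γ') (v : V) : Γ.labelGroup v ≤ Γ'.labelGroup (φ.onV v) := by
  intro x hx
  obtain ⟨w, hw, rfl⟩ := mem_labelGroup.1 hx
  refine mem_labelGroup.2 ⟨_, hw.map φ, ?_⟩
  simp [word, φ.lab_onE, Function.comp_def]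

end Hom

section FiberProduct

variable {V₁ V₂ E₁ E₂ : Type*} {Γ₁ : LabeledGraph X V₁ E₁} {Γ₂ : LabeledGraph X V₂ E₂}

lemma exists_lift_walk (φ₁ : Hom Γ Γ₁) (φ₂ : Hom Γ Γ₂)
    (hlift : ∀ s b e₁ e₂, Γ₁.lab e₁ = Γ₂.lab e₂ → Γ₁.ini (e₁, b) = φ₁.onV s →
      Γ₂.ini (e₂, b) = φ₂.onV s → ∃ e, Γ.ini (e, b) = s ∧ φ₁.onE e = e₁ ∧ φ₂.onE e = e₂)
    (s : V) (v₁ : V₁) (v₂ : V₂) (w₁ : List (E₁ × Bool)) (w₂ : List (E₂ × Bool))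
    (h₁ : Γ₁.IsWalk (φ₁.onV s) w₁ v₁) (h₂ : Γ₂.IsWalk (φ₂.onV s) w₂ v₂)
    (hw : Γ₁.word w₁ = Γ₂.word w₂) :
    ∃ w t, Γ.IsWalk s w t ∧ Γ.word w = Γ₁.word w₁ ∧ φ₁.onV t = v₁ ∧ φ₂.onV t = v₂ := by
  induction w₁ generalizing s w₂ with
  | nil =>
    obtain rfl : w₂ = [] := List.map_eq_nil_iff.1 hw.symm
    exact ⟨[], s, rfl, rfl, h₁, h₂⟩
  | cons a₁ w₁ ih =>
    cases w₂ with
    | nil => simp [word] at hw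
    | cons a₂ w₂ =>
      obtain ⟨e₁, b⟩ := a₁
      obtain ⟨e₂, b₂⟩ := a₂
      simp only [word, List.map_cons, List.cons.injEq, Prod.mk.injEq] at hw
      obtain ⟨⟨hl, rfl⟩, hw⟩ := hw
      obtain ⟨e, rfl, rfl, rfl⟩ := hlift s b e₁ e₂ hl h₁.1 h₂.1
      have h₁' := h₁.2
      have h₂' := h₂.2
      simp only [Hom.ini_onE] at h₁' h₂'
      obtain ⟨w, t, hwt, hwd, ht⟩ := ih _ w₂ h₁' h₂' hw
      refine ⟨(e, b) :: w, t, ⟨rfl, hwt⟩, ?_, ht⟩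
      simp only [word, List.map_cons, φ₁.lab_onE] at hwd ⊢
      rw [hwd]

theorem labelGroup_eq_inf (φ₁ : Hom Γ Γ₁) (φ₂ : Hom Γ Γ₂)
    (hinj : ∀ s t, φ₁.onV s = φ₁.onV t → φ₂.onV s = φ₂.onV t → s = t)
    (hlift : ∀ s b e₁ e₂, Γ₁.lab e₁ = Γ₂.lab e₂ → Γ₁.ini (e₁, b) = φ₁.onV s →
      Γ₂.ini (e₂, b) = φ₂.onV s → ∃ e, Γ.ini (e, b) = s ∧ φ₁.onE e = e₁ ∧ φ₂.onE e = e₂)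
    (hΓ₁ : Γ₁.Folded) (hΓ₂ : Γ₂.Folded) (v : V) :
    Γ.labelGroup v = Γ₁.labelGroup (φ₁.onV v) ⊓ Γ₂.labelGroup (φ₂.onV v) := by
  classical
  refine le_antisymm (le_inf (labelGroup_le φ₁ v) (labelGroup_le φ₂ v)) ?_
  rintro x ⟨hx₁, hx₂⟩
  obtain ⟨w₁, h₁, hw₁⟩ := hΓ₁.exists_word_eq_toWord hx₁
  obtain ⟨w₂, h₂, hw₂⟩ := hΓ₂.exists_word_eq_toWord hx₂
  obtain ⟨w, t, hw, hwd, ht₁, ht₂⟩ :=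
    exists_lift_walk φ₁ φ₂ hlift v _ _ w₁ w₂ h₁ h₂ (hw₁.trans hw₂.symm)
  obtain rfl := hinj t v ht₁ ht₂
  exact mem_labelGroup.2 ⟨w, hw, by rw [hwd, hw₁, FreeGroup.mk_toWord]⟩

end FiberProduct

/-! ### Graphs labelled by two letters -/

section TwoLetter

variable {A B : Type*}

/-- The graph with edges `s i ⟶ t i` labelled `a` and edges `s' i ⟶ t' i` labelled `b`. -/
def twoLetter (a b : X) (s t : A → V) (s' t' : B → V) : LabeledGraph X V (A ⊕ B) where
  src := Sum.elim s s'
  tgt := Sum.elim t t'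
  lab := Sum.elim (fun _ => a) (fun _ => b)

lemma folded_twoLetter {a b : X} (hab : a ≠ b) {s t : A → V} {s' t' : B → V}
    (hs : Function.Injective s) (ht : Function.Injective t) (hs' : Function.Injective s')
    (ht' : Function.Injective t') : (twoLetter a b s t s' t').Folded := by
  rintro (_ | _) (i | i) (j | j) hl h
  · exact congrArg _ (ht h)
  · exact absurd hl hab
  · exact absurd hl hab.symm
  · exact congrArg _ (ht' h)
  · exact congrArg _ (hs h)
  · exact absurd hl hab
  · exact absurd hl hab.symm
  · exact congrArg _ (hs' h)

lemma labelGroup_prod_twoLetter {V₁ V₂ A₁ A₂ B₁ B₂ : Type*} {a b : X} (hab : a ≠ b)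
    {s₁ t₁ : A₁ → V₁} {s₁' t₁' : B₁ → V₁} {s₂ t₂ : A₂ → V₂} {s₂' t₂' : B₂ → V₂}
    (h₁ : (twoLetter a b s₁ t₁ s₁' t₁').Folded) (h₂ : (twoLetter a b s₂ t₂ s₂' t₂').Folded)
    (v₁ : V₁) (v₂ : V₂) :
    (twoLetter a b (Prod.map s₁ s₂) (Prod.map t₁ t₂) (Prod.map s₁' s₂')
      (Prod.map t₁' t₂')).labelGroup (v₁, v₂) =
    (twoLetter a b s₁ t₁ s₁' t₁').labelGroup v₁ ⊓
      (twoLetter a b s₂ t₂ s₂' t₂').labelGroup v₂ := by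
  refine labelGroup_eq_inf
    (φ₁ := ⟨Prod.fst, Sum.map Prod.fst Prod.fst, ?_, ?_, ?_⟩)
    (φ₂ := ⟨Prod.snd, Sum.map Prod.snd Prod.snd, ?_, ?_, ?_⟩)
    (fun s t h h' => Prod.ext h h') ?_ h₁ h₂ (v₁, v₂)
  iterate 6 rintro (_ | _) <;> rfl
  rintro ⟨x, y⟩ b' (i | i) (j | j) hl h h'
  · exact ⟨.inl (i, j), by cases b' <;> exact Prod.ext h h', rfl, rfl⟩
  · exact absurd hl hab
  · exact absurd hl hab.symm
  · exact ⟨.inr (i, j), by cases b' <;> exact Prod.ext h h', rfl, rfl⟩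

/-- A path of edges labelled `a`, with loops labelled `b` at the vertices in `S`. -/
abbrev pathWithLoops (a b : X) (k : ℕ) (S : Finset (Fin (k + 1))) :
    LabeledGraph X (Fin (k + 1)) (Fin k ⊕ S) :=
  twoLetter a b Fin.castSucc Fin.succ Subtype.val Subtype.val

/-- A cycle of edges labelled `a`, with loops labelled `b` at the vertices in `S`. -/
abbrev cycleWithLoops (a b : X) (k : ℕ) (S : Finset (Fin (k + 1))) :
    LabeledGraph X (Fin (k + 1)) (Fin (k + 1) ⊕ S) :=
  twoLetter a b id (· + 1) Subtype.val Subtype.val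

/-- A path of edges labelled `a`, whose vertices form a cycle of edges labelled `b`. -/
abbrev pathInCycle (a b : X) (p : ℕ) :
    LabeledGraph X (Fin (p + 1)) (Fin p ⊕ Fin (p + 1)) :=
  twoLetter a b Fin.castSucc Fin.succ id (· + 1)

lemma connectedFrom_of_path {a b : X} {k : ℕ} {s' t' : B → Fin (k + 1)} :
    (twoLetter a b Fin.castSucc Fin.succ s' t').ConnectedFrom 0 := by
  intro S h0 h u
  induction u using Fin.induction with
  | zero => exact h0
  | succ i ih => exact (h (.inl i)).1 ih

lemma connectedFrom_cycleWithLoops {a b : X} {k : ℕ} {S : Finset (Fin (k + 1))} :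
    (cycleWithLoops a b k S).ConnectedFrom 0 := by
  intro S h0 h u
  induction u using Fin.induction with
  | zero => exact h0
  | succ i ih =>
    rw [← Fin.coeSucc_eq_succ]
    exact (h (.inl i.castSucc)).1 ih

variable {a b : X}

lemma folded_pathWithLoops (hab : a ≠ b) (k : ℕ) (S : Finset (Fin (k + 1))) :
    (pathWithLoops a b k S).Folded :=
  folded_twoLetter hab (Fin.castSucc_injective k) (Fin.succ_injective k) Subtype.val_injective
    Subtype.val_injective

lemma folded_cycleWithLoops (hab : a ≠ b) (k : ℕ) (S : Finset (Fin (k + 1))) :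
    (cycleWithLoops a b k S).Folded :=
  folded_twoLetter hab Function.injective_id (add_left_injective 1) Subtype.val_injective
    Subtype.val_injective

lemma folded_pathInCycle (hab : a ≠ b) (p : ℕ) : (pathInCycle a b p).Folded :=
  folded_twoLetter hab (Fin.castSucc_injective p) (Fin.succ_injective p) Function.injective_id
    (add_left_injective 1)

lemma hasRank_pathWithLoops (hab : a ≠ b) (k : ℕ) (S : Finset (Fin (k + 1))) :
    ((pathWithLoops a b k S).labelGroup 0).HasRank S.card :=
  connectedFrom_of_path.hasRank_labelGroup (folded_pathWithLoops hab k S) (by simp; omega)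

lemma hasRank_cycleWithLoops (hab : a ≠ b) (k : ℕ) (S : Finset (Fin (k + 1))) :
    ((cycleWithLoops a b k S).labelGroup 0).HasRank (S.card + 1) :=
  connectedFrom_cycleWithLoops.hasRank_labelGroup (folded_cycleWithLoops hab k S)
    (by simp; omega)

lemma hasRank_pathInCycle (hab : a ≠ b) (p : ℕ) :
    ((pathInCycle a b p).labelGroup 0).HasRank (p + 1) :=
  connectedFrom_of_path.hasRank_labelGroup (folded_pathInCycle hab p) (by simp; omega)

lemma labelGroup_pathWithLoops_inf (hab : a ≠ b) (k : ℕ) (S T : Finset (Fin (k + 1))) :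
    (pathWithLoops a b k (S ∩ T)).labelGroup 0 =
      (pathWithLoops a b k S).labelGroup 0 ⊓ (pathWithLoops a b k T).labelGroup 0 := by
  refine labelGroup_eq_inf
    (φ₁ := ⟨id, Sum.map id fun i => ⟨i, (Finset.mem_inter.1 i.2).1⟩, ?_, ?_, ?_⟩)
    (φ₂ := ⟨id, Sum.map id fun i => ⟨i, (Finset.mem_inter.1 i.2).2⟩, ?_, ?_, ?_⟩)
    (fun s t h _ => h) ?_ (folded_pathWithLoops hab k S) (folded_pathWithLoops hab k T) 0
  iterate 6 rintro (_ | _) <;> rfl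
  rintro s c (i | ⟨i, hi⟩) (j | ⟨j, hj⟩) hl h h'
  · obtain rfl : i = j := by
      cases c
      · exact Fin.succ_injective k (h.trans h'.symm)
      · exact Fin.castSucc_injective k (h.trans h'.symm)
    exact ⟨.inl i, by cases c <;> exact h, rfl, rfl⟩
  · exact absurd hl hab
  · exact absurd hl hab.symm
  · obtain rfl : i = j := by cases c <;> exact h.trans h'.symm
    exact ⟨.inr ⟨i, Finset.mem_inter.2 ⟨hi, hj⟩⟩, by cases c <;> exact h, rfl, rfl⟩

/-- The fibre product of `pathInCycle a b p` and `cycleWithLoops a b k S` is connected as soon as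
every multiple of `p` carries a loop. -/
lemma connectedFrom_prod {p k : ℕ} (hp : 0 < p) {S : Finset (Fin (k + 1))}
    (hS : ∀ j : Fin (k + 1), p ∣ j.val → j ∈ S) :
    (twoLetter a b (Prod.map (Fin.castSucc (n := p)) (id : Fin (k + 1) → Fin (k + 1)))
      (Prod.map Fin.succ (· + 1)) (Prod.map (id : Fin (p + 1) → Fin (p + 1)) (Subtype.val : S → _))
      (Prod.map (· + 1) Subtype.val)).ConnectedFrom (0, 0) := by
  intro T h0 hT
  let Q (u j : ℕ) : Prop := (Fin.ofNat (p + 1) u, Fin.ofNat (k + 1) j) ∈ T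
  have hsucc : ∀ n i, Fin.ofNat (n + 1) (i + 1) = Fin.ofNat (n + 1) i + 1 := fun n i => by
    ext; simp [Fin.val_add]
  have hwrap : ∀ u, Q u (k + 1) ↔ Q u 0 := fun u => by simp [Q]
  have hdiag : ∀ u j, u < p → (Q u j ↔ Q (u + 1) (j + 1)) := fun u j hu => by
    have h := hT (.inl (⟨u, hu⟩, Fin.ofNat (k + 1) j))
    have e₁ : Fin.ofNat (p + 1) u = Fin.castSucc ⟨u, hu⟩ :=
      Fin.ext (Nat.mod_eq_of_lt (Nat.lt_succ_of_lt hu))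
    have e₂ : Fin.ofNat (p + 1) (u + 1) = Fin.succ ⟨u, hu⟩ :=
      Fin.ext (Nat.mod_eq_of_lt (Nat.succ_lt_succ hu))
    simp only [Q, e₁, e₂, hsucc k]
    exact h
  have hdiag' : ∀ t u j, u + t ≤ p → (Q u j ↔ Q (u + t) (j + t)) := fun t => by
    induction t with
    | zero => simp
    | succ t ih =>
      intro u j hu
      rw [ih u j (by omega), hdiag _ _ (by omega)]
      rfl
  have hvert : ∀ j, j ≤ k → p ∣ j → ∀ u, Q u j ↔ Q 0 j := fun j hj hpj u => by
    have hmem : Fin.ofNat (k + 1) j ∈ S := hS _ (by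
      rwa [Fin.val_ofNat, Nat.mod_eq_of_lt (Nat.lt_succ_of_le hj)])
    induction u with
    | zero => rfl
    | succ u ih =>
      refine Iff.trans ?_ ih
      have h := hT (.inr (Fin.ofNat (p + 1) u, ⟨_, hmem⟩))
      simp only [Q, hsucc p]
      exact h.symm
  have hblock : ∀ c, p * c ≤ k → ∀ u, Q u (p * c) := fun c => by
    induction c with
    | zero =>
      intro _ u
      rw [hvert _ (by simp) (by simp)]
      simpa [Q] using h0
    | succ c ih =>
      intro hc u
      rw [hvert _ hc (dvd_mul_right _ _), ← hvert _ hc (dvd_mul_right _ _) (0 + p), Nat.mul_succ,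
        ← hdiag' p 0 _ (by omega)]
      exact ih (by rw [Nat.mul_succ] at hc; omega) 0
  have hall : ∀ u j, u ≤ p → j ≤ k → Q u j := fun u j hu hj => by
    have hdm := Nat.div_add_mod j p
    have hlt := Nat.mod_lt j hp
    have hms : p * (j / p + 1) = p * (j / p) + p := Nat.mul_succ _ _
    by_cases hut : j % p ≤ u
    · have h := (hdiag' (j % p) (u - j % p) (p * (j / p)) (by omega)).1
        (hblock (j / p) (by omega) _)
      rwa [Nat.sub_add_cancel hut, hdm] at h
    · by_cases hjk : p * (j / p + 1) ≤ k
      · rw [hdiag' (p - j % p) u j (by omega)]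
        have h := hblock _ hjk (u + (p - j % p))
        rwa [show p * (j / p + 1) = j + (p - j % p) by omega] at h
      · rw [hdiag' (k + 1 - j) u j (by omega), show j + (k + 1 - j) = k + 1 by omega, hwrap]
        exact hblock 0 (by simp) _
  rintro ⟨u, j⟩
  simpa [Q] using hall u j (by omega) (by omega)

end TwoLetter

end LabeledGraph

open LabeledGraph

lemma exists_hasRank_inf_of_le {X : Type*} {a b : X} (hab : a ≠ b) {m n N : ℕ}
    (hm : N ≤ m) (hn : N ≤ n) : ∃ H K : Subgroup (FreeGroup X),
      H.HasRank m ∧ K.HasRank n ∧ (H ⊓ K).HasRank N := by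
  have hcard : ∀ c d, c ≤ d → d ≤ m + n →
      (Finset.univ.filter fun i : Fin (m + n + 1) => c ≤ i.val ∧ i.val < d).card = d - c := by
    intro c d hcd hd
    rw [← Nat.card_Ico, ← Finset.card_map Fin.valEmbedding]
    congr 1
    ext i
    simp only [Finset.mem_map, Finset.mem_filter, Finset.mem_univ, true_and,
      Fin.valEmbedding_apply, Finset.mem_Ico]
    exact ⟨by rintro ⟨i, h, rfl⟩; exact h, fun h => ⟨⟨i, by omega⟩, h, rfl⟩⟩
  set S := Finset.univ.filter fun i : Fin (m + n + 1) => 0 ≤ i.val ∧ i.val < m with hS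
  set T := Finset.univ.filter fun i : Fin (m + n + 1) => m - N ≤ i.val ∧ i.val < m - N + n with hT
  have hST : S ∩ T = Finset.univ.filter fun i : Fin (m + n + 1) => m - N ≤ i.val ∧ i.val < m := by
    ext i
    simp only [hS, hT, Finset.mem_inter, Finset.mem_filter, Finset.mem_univ, true_and]
    omega
  have hS' := hasRank_pathWithLoops hab _ S
  have hT' := hasRank_pathWithLoops hab _ T
  have hST' := hasRank_pathWithLoops hab _ (S ∩ T)
  rw [labelGroup_pathWithLoops_inf hab, hST, hcard _ _ (by omega) (by omega)] at hST'
  rw [hcard _ _ (by omega) (by omega)] at hS' hT'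
  exact ⟨_, _, by convert! hS' using 1, by convert! hT' using 1; omega,
    by convert! hST' using 1; omega⟩

lemma exists_hasRank_inf_of_ge {X : Type*} {a b : X} (hab : a ≠ b) {p q M : ℕ} (hp : 0 < p)
    (hM : q ≤ M) (hM' : M ≤ p * q) (hq : 0 < q) : ∃ H K : Subgroup (FreeGroup X),
      H.HasRank (p + 1) ∧ K.HasRank (q + 1) ∧ (H ⊓ K).HasRank (M + 1) := by
  have hpq : (p + 1) * q = p * q + q := by ring
  obtain ⟨k, hk⟩ : ∃ k, k + 1 + M = (p + 1) * q := ⟨(p + 1) * q - M - 1, by omega⟩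
  have hS₀ : (Finset.univ.filter fun j : Fin (k + 1) => p ∣ j.val).card ≤ q := by
    rw [← Finset.card_range q]
    refine Finset.card_le_card_of_injOn (fun j => j.val / p) (fun j _ => ?_) ?_
    · simp only [Finset.coe_range, Set.mem_Iio]
      exact Nat.div_lt_of_lt_mul (by omega)
    · intro i hi j hj h
      simp only [Finset.coe_filter, Finset.mem_univ, true_and, Set.mem_ofPred_eq] at hi hj
      exact Fin.ext ((Nat.div_left_inj hi hj).1 h)
  obtain ⟨S, hS, hSq⟩ := Finset.exists_superset_card_eq hS₀ (by simp; omega)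
  have hcard := hasRank_cycleWithLoops hab k S
  rw [hSq] at hcard
  refine ⟨_, _, hasRank_pathInCycle hab p, hcard, ?_⟩
  rw [← labelGroup_prod_twoLetter hab (folded_pathInCycle hab p) (folded_cycleWithLoops hab k S)]
  refine (connectedFrom_prod hp fun j hj => hS (by simpa using hj)).hasRank_labelGroup
    (folded_twoLetter hab ((Fin.castSucc_injective p).prodMap Function.injective_id)
      ((Fin.succ_injective p).prodMap (add_left_injective 1))
      (Function.injective_id.prodMap Subtype.val_injective)
      ((add_left_injective 1).prodMap Subtype.val_injective)) ?_
  simp only [Fintype.card_prod, Fintype.card_fin, Fintype.card_sum, Fintype.card_coe, hSq]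
  have : (p + 1) * (k + 1) = p * (k + 1) + (k + 1) := by ring
  omega

theorem stmt_2 {ι : Type} (hι : 2 ≤ Cardinal.mk ι) (m n N : ℕ)
    (hm : 2 ≤ m) (hn : 2 ≤ n) (hN1 : 1 ≤ N - 1) (hN2 : N - 1 ≤ (m - 1) * (n - 1)) :
    ∃ (H K : Subgroup (FreeGroup ι)) (hH : Group.FG ↥H) (hK : Group.FG ↥K)
      (hI : Group.FG ↥(H ⊓ K)),
      @Group.rank ↥H _ hH = m ∧ @Group.rank ↥K _ hK = n ∧
      @Group.rank ↥(H ⊓ K) _ hI = N := by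
  obtain ⟨a, b, hab⟩ := Cardinal.two_le_iff.1 hι
  obtain ⟨p, rfl⟩ : ∃ p, m = p + 1 := ⟨m - 1, by omega⟩
  obtain ⟨q, rfl⟩ : ∃ q, n = q + 1 := ⟨n - 1, by omega⟩
  obtain ⟨M, rfl⟩ : ∃ M, N = M + 1 := ⟨N - 1, by omega⟩
  simp only [Nat.add_sub_cancel] at hN1 hN2
  obtain ⟨H, K, ⟨hH, hm'⟩, ⟨hK, hn'⟩, ⟨hI, hN'⟩⟩ : ∃ H K : Subgroup (FreeGroup ι),
      H.HasRank (p + 1) ∧ K.HasRank (q + 1) ∧ (H ⊓ K).HasRank (M + 1) := by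
    by_cases h : M ≤ p ∧ M ≤ q
    · exact exists_hasRank_inf_of_le hab (by omega) (by omega)
    · by_cases hqM : q ≤ M
      · exact exists_hasRank_inf_of_ge hab (by omega) hqM hN2 (by omega)
      · obtain ⟨K, H, hK, hH, hI⟩ := exists_hasRank_inf_of_ge hab (p := q) (q := p) (M := M)
          (by omega) (by omega) (by rwa [mul_comm]) (by omega)
        exact ⟨H, K, hH, hK, by rwa [inf_comm]⟩
  exact ⟨H, K, hH, hK, hI, hm', hn', hN'⟩
end

section
/- In the free group F(a,b), let H = ⟨a, bab⁻¹, ..., b^k a b^{-k}, b^{k+1} a^{n-ℓ} b^{-(k+1)}, b^{k+2} a^n b^{-(k+2)}, ..., b^{m-1} a^n b^{1-m}⟩ and K = ⟨b, aba⁻¹, ..., a^{n-1} b a^{1-n}⟩, where 0 ≤ k ≤ m-2 and 0 ≤ ℓ ≤ n-1. Then the rank of H ∩ K equals k(n-1) + ℓ. -/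
namespace FreeGroup

section Automaton

variable {α S : Type*}

/-- One step of an automaton with `α`-labelled edges `E`; inverse letters traverse edges backwards. -/
def EdgeStep (E : α → S → S → Prop) (p : α × Bool) (s t : S) : Prop :=
  if p.2 then E p.1 s t else E p.1 t s

/-- The word `L` labels a path from `s` to `t` in the automaton `E`. -/
def Reads (E : α → S → S → Prop) : List (α × Bool) → S → S → Prop
  | [], s, t => s = t
  | p :: L, s, t => ∃ u, EdgeStep E p s u ∧ Reads E L u t

/-- No two edges with the same label share their source or their target. -/
structure Folded (E : α → S → S → Prop) : Prop where
  target_unique : ∀ {x s t t'}, E x s t → E x s t' → t = t'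
  source_unique : ∀ {x s s' t}, E x s t → E x s' t → s = s'

theorem reads_append {E : α → S → S → Prop} {L L' : List (α × Bool)} {s t : S} :
    Reads E (L ++ L') s t ↔ ∃ u, Reads E L s u ∧ Reads E L' u t := by
  induction L generalizing s with
  | nil => simp [Reads]
  | cons p L ih =>
    simp only [List.cons_append, Reads, ih]
    grind

theorem reads_invRev {E : α → S → S → Prop} {L : List (α × Bool)} {s t : S}
    (h : Reads E L s t) : Reads E (invRev L) t s := by
  induction L generalizing s with
  | nil => exact h.symm
  | cons p L ih =>
    obtain ⟨u, hp, hL⟩ := h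
    rw [invRev_cons, reads_append]
    refine ⟨u, ih hL, s, ?_, rfl⟩
    rcases p with ⟨x, _ | _⟩ <;> simpa [EdgeStep] using hp

theorem Folded.reads_of_red {E : α → S → S → Prop} (hE : Folded E) {L L' : List (α × Bool)}
    (h : Red L L') {s t : S} (hL : Reads E L s t) : Reads E L' s t := by
  induction h with
  | refl => exact hL
  | tail _ hstep ih =>
    obtain @⟨L₁, L₂, x, b⟩ := hstep
    rw [reads_append] at ih ⊢
    obtain ⟨u, h₁, v, huv, w, hvw, h₂⟩ := ih
    have : u = w := by
      cases b
      · exact hE.target_unique (by simpa [EdgeStep] using huv) (by simpa [EdgeStep] using hvw)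
      · exact hE.source_unique (by simpa [EdgeStep] using huv) (by simpa [EdgeStep] using hvw)
    exact ⟨u, h₁, this ▸ h₂⟩

variable [DecidableEq α]

/-- The reduced word of `w` labels a path from `s` to `t`. -/
def Accepts (E : α → S → S → Prop) (w : FreeGroup α) (s t : S) : Prop :=
  Reads E w.toWord s t

theorem Accepts.one (E : α → S → S → Prop) (s : S) : Accepts E 1 s s := by
  simp [Accepts, Reads]

theorem Accepts.of {E : α → S → S → Prop} {x : α} {s t : S} (h : E x s t) :
    Accepts E (of x) s t := by
  simpa [Accepts, Reads, EdgeStep] using h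

theorem Accepts.inv {E : α → S → S → Prop} {w : FreeGroup α} {s t : S}
    (h : Accepts E w s t) : Accepts E w⁻¹ t s := by
  rw [Accepts, toWord_inv]
  exact reads_invRev h

theorem Accepts.mul {E : α → S → S → Prop} (hE : Folded E) {v w : FreeGroup α} {s t u : S}
    (hv : Accepts E v s t) (hw : Accepts E w t u) : Accepts E (v * w) s u := by
  rw [Accepts, toWord_mul]
  exact hE.reads_of_red reduce.red (reads_append.2 ⟨t, hv, hw⟩)

theorem Accepts.pow {E : α → S → S → Prop} (hE : Folded E) {w : FreeGroup α} {f : ℕ → S} {m : ℕ}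
    (h : ∀ i < m, Accepts E w (f i) (f (i + 1))) : Accepts E (w ^ m) (f 0) (f m) := by
  induction m with
  | zero => simpa using Accepts.one E (f 0)
  | succ m ih =>
    rw [pow_succ]
    exact (ih fun i hi => h i (by omega)).mul hE (h m (by omega))

theorem accepts_of_mem_closure {E : α → S → S → Prop} (hE : Folded E) {s : S}
    {T : Set (FreeGroup α)} (hT : ∀ w ∈ T, Accepts E w s s) {w : FreeGroup α}
    (hw : w ∈ Subgroup.closure T) : Accepts E w s s := by
  induction hw using Subgroup.closure_induction with
  | mem w hw => exact hT w hw
  | one => exact Accepts.one E s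
  | mul v w _ _ hv hw => exact hv.mul hE hw
  | inv w _ hw => exact hw.inv

theorem Accepts.prod {S' : Type*} {E : α → S → S → Prop} {E' : α → S' → S' → Prop}
    {w : FreeGroup α} {s t : S} {s' t' : S'} (h : Accepts E w s t) (h' : Accepts E' w s' t') :
    Accepts (fun x (p q : S × S') => E x p.1 q.1 ∧ E' x p.2 q.2) w (s, s') (t, t') := by
  unfold Accepts at *
  generalize w.toWord = L at *
  induction L generalizing s s' with
  | nil => exact Prod.ext h h'
  | cons p L ih =>
    obtain ⟨u, hu, hL⟩ := h
    obtain ⟨u', hu', hL'⟩ := h'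
    refine ⟨(u, u'), ?_, ih hL hL'⟩
    unfold EdgeStep at *
    split_ifs at * <;> exact ⟨hu, hu'⟩

/-- If `τ` is a choice of labels for the vertices such that every edge closes up to an element of
`C`, then so does every path. -/
theorem Accepts.mul_mul_inv_mem {E : α → S → S → Prop} {C : Subgroup (FreeGroup α)}
    {τ : S → FreeGroup α} (hτ : ∀ x s t, E x s t → τ s * FreeGroup.of x * (τ t)⁻¹ ∈ C)
    {w : FreeGroup α} {s t : S} (h : Accepts E w s t) : τ s * w * (τ t)⁻¹ ∈ C := by
  suffices ∀ L : List (α × Bool), Reads E L s t → τ s * mk L * (τ t)⁻¹ ∈ C by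
    simpa [mk_toWord] using this w.toWord h
  clear h
  intro L h
  induction L generalizing s with
  | nil => simp [show s = t from h, ← one_eq_mk]
  | cons p L ih =>
    obtain ⟨u, hp, hL⟩ := h
    have hstep : τ s * mk [p] * (τ u)⁻¹ ∈ C := by
      rcases p with ⟨x, _ | _⟩
      · simpa [FreeGroup.of, inv_mk, invRev, mul_assoc] using
          C.inv_mem (hτ x u s (by simpa [EdgeStep] using hp))
      · exact hτ x s u (by simpa [EdgeStep] using hp)
    have := C.mul_mem hstep (ih hL)
    rw [← List.singleton_append, ← mul_mk]
    simpa only [mul_assoc, inv_mul_cancel_left] using this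

end Automaton

end FreeGroup

theorem Module.finrank_le_rank_of_span_range_eq_top {R G V : Type*} [Field R] [Group G]
    [AddCommGroup V] [Module R V] [Group.FG G] (φ : G →* Multiplicative V)
    (hφ : Submodule.span R (Set.range fun g => (φ g).toAdd) = ⊤) :
    Module.finrank R V ≤ Group.rank G := by
  classical
  obtain ⟨T, hT, hT'⟩ := Group.rank_spec G
  have hmem : ∀ g ∈ Subgroup.closure (T : Set G),
      (φ g).toAdd ∈ Submodule.span R ((T.image fun g => (φ g).toAdd : Finset V) : Set V) := by
    intro g hg
    induction hg using Subgroup.closure_induction with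
    | mem g hg => exact Submodule.subset_span (by simpa using ⟨g, hg, rfl⟩)
    | one => simp
    | mul g h _ _ hg hh => simpa using add_mem hg hh
    | inv g _ hg => simpa using hg
  have htop : Submodule.span R ((T.image fun g => (φ g).toAdd : Finset V) : Set V) = ⊤ := by
    rw [eq_top_iff, ← hφ, Submodule.span_le]
    rintro _ ⟨g, rfl⟩
    exact hmem g (hT' ▸ Subgroup.mem_top g)
  rw [← finrank_top R V, ← htop, ← hT]
  exact (finrank_span_finset_le_card _).trans Finset.card_image_le

section GridAction

variable {V : Type*} [AddCommGroup V] (P : ℤ → ℤ → V)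

/-- Move down by one in the second coordinate. -/
def gridShiftSnd (V : Type*) : Equiv.Perm (ℤ × ℤ × V) where
  toFun x := (x.1, x.2.1 - 1, x.2.2)
  invFun x := (x.1, x.2.1 + 1, x.2.2)
  left_inv x := by simp
  right_inv x := by simp

/-- Move down by one in the first coordinate, adding the change of the potential `P`. -/
def gridShiftFst : Equiv.Perm (ℤ × ℤ × V) where
  toFun x := (x.1 - 1, x.2.1, x.2.2 + (P (x.1 - 1) x.2.1 - P x.1 x.2.1))
  invFun x := (x.1 + 1, x.2.1, x.2.2 + (P (x.1 + 1) x.2.1 - P x.1 x.2.1))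
  left_inv x := by ext <;> simp [add_assoc]
  right_inv x := by ext <;> simp [add_assoc]

/-- The action of the free group on the `V`-covering of the grid with potential `P`. -/
def gridAction : FreeGroup Bool →* Equiv.Perm (ℤ × ℤ × V) :=
  FreeGroup.lift fun x => if x then gridShiftSnd V else gridShiftFst P

/-- The exponent sum of a generator. -/
def expSum (x : Bool) : FreeGroup Bool →* Multiplicative ℤ :=
  FreeGroup.lift fun y => Multiplicative.ofAdd (if y = x then 1 else 0)

theorem gridAction_of_true_pow (s : ℕ) (i j : ℤ) (v : V) :
    gridAction P (FreeGroup.of true ^ s) (i, j, v) = (i, j - s, v) := by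
  induction s generalizing j with
  | zero => simp
  | succ s ih =>
    rw [pow_succ, map_mul, Equiv.Perm.mul_apply]
    have : gridAction P (FreeGroup.of true) (i, j, v) = (i, j - 1, v) := by
      simp [gridAction, gridShiftSnd]
    rw [this, ih]
    push_cast
    ring_nf

theorem gridAction_of_false_pow (s : ℕ) (i j : ℤ) (v : V) :
    gridAction P (FreeGroup.of false ^ s) (i, j, v) = (i - s, j, v + (P (i - s) j - P i j)) := by
  induction s generalizing i v with
  | zero => simp
  | succ s ih =>
    rw [pow_succ, map_mul, Equiv.Perm.mul_apply]
    have : gridAction P (FreeGroup.of false) (i, j, v) =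
        (i - 1, j, v + (P (i - 1) j - P i j)) := by
      simp [gridAction, gridShiftFst]
    rw [this, ih, show i - 1 - (s : ℤ) = i - ((s + 1 : ℕ) : ℤ) by push_cast; ring]
    congr 2
    abel

theorem gridAction_apply (w : FreeGroup Bool) (i j : ℤ) :
    ∃ u : V, ∀ v, gridAction P w (i, j, v) =
      (i - (expSum false w).toAdd, j - (expSum true w).toAdd, v + u) := by
  induction w using FreeGroup.induction_on generalizing i j with
  | C1 => exact ⟨0, by simp⟩
  | of x =>
    cases x
    · exact ⟨P (i - 1) j - P i j, by simp [gridAction, gridShiftFst, expSum]⟩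
    · exact ⟨0, by simp [gridAction, gridShiftSnd, expSum]⟩
  | inv_of x h =>
    obtain ⟨u, hu⟩ := h (i + (expSum false (FreeGroup.of x)).toAdd)
      (j + (expSum true (FreeGroup.of x)).toAdd)
    refine ⟨-u, fun v => ?_⟩
    rw [map_inv, Equiv.Perm.inv_eq_iff_eq]
    simp [hu]
  | mul x y hx hy =>
    obtain ⟨u, hu⟩ := hy i j
    obtain ⟨u', hu'⟩ := hx (i - (expSum false y).toAdd) (j - (expSum true y).toAdd)
    refine ⟨u + u', fun v => ?_⟩
    rw [map_mul, Equiv.Perm.mul_apply, hu, hu']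
    simp only [map_mul, toAdd_mul, Prod.mk.injEq]
    refine ⟨by ring, by ring, by abel⟩

/-- The holonomy at the origin, on a subgroup of elements with vanishing exponent sums. -/
def gridHolonomy (L : Subgroup (FreeGroup Bool)) (hL : ∀ x, L ≤ (expSum x).ker) :
    L →* Multiplicative V :=
  MonoidHom.mk' (fun w => Multiplicative.ofAdd (gridAction P w (0, 0, 0)).2.2) fun w w' => by
    obtain ⟨u, hu⟩ := gridAction_apply P (w : FreeGroup Bool) 0 0
    obtain ⟨u', hu'⟩ := gridAction_apply P (w' : FreeGroup Bool) 0 0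
    have h (x) (y : L) : expSum x y = 1 := hL x y.2
    simp only [h, toAdd_one, sub_zero] at hu hu'
    rw [Subgroup.coe_mul, map_mul, Equiv.Perm.mul_apply, hu', hu, hu]
    simp [← ofAdd_add, add_comm]

end GridAction

/-- The loop around the part of the grid between rows `0` and `i` and columns `j` and `j + s`. -/
def gridLoop (i j s : ℕ) : FreeGroup Bool :=
  FreeGroup.of true ^ j * (FreeGroup.of false ^ i * FreeGroup.of true ^ s *
    (FreeGroup.of false ^ i)⁻¹) * (FreeGroup.of true ^ (j + s))⁻¹

theorem gridAction_gridLoop {V : Type*} [AddCommGroup V] (P : ℤ → ℤ → V) (hP : ∀ j, P 0 j = 0)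
    (i j s : ℕ) :
    gridAction P (gridLoop i j s) (0, 0, 0) = (0, 0, P i (j + s) - P i j) := by
  have h₁ : gridAction P (FreeGroup.of true ^ (j + s))⁻¹ (0, 0, 0) = (0, (j + s : ℤ), 0) := by
    rw [map_inv, Equiv.Perm.inv_eq_iff_eq, gridAction_of_true_pow]
    simp
  have h₂ : gridAction P (FreeGroup.of false ^ i)⁻¹ (0, (j + s : ℤ), 0) =
      ((i : ℤ), (j + s : ℤ), P i (j + s)) := by
    rw [map_inv, Equiv.Perm.inv_eq_iff_eq, gridAction_of_false_pow]
    simp [hP]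
  simp only [gridLoop, map_mul, Equiv.Perm.mul_apply, h₁, h₂, gridAction_of_true_pow,
    gridAction_of_false_pow]
  simp [hP, sub_eq_add_neg]

/-- The automaton with a `false`-labelled ray and, at its `i`-th vertex, a `true`-labelled cycle of
length `p i`. -/
def cyclesOnRay (p : ℕ → ℕ) (x : Bool) (s t : ℕ × ℕ) : Prop :=
  if x then t.1 = s.1 ∧ (t.2 = s.2 + 1 ∧ t.2 < p s.1 ∨ t.2 = 0 ∧ s.2 + 1 = p s.1)
  else t.1 = s.1 + 1 ∧ s.2 = 0 ∧ t.2 = 0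

/-- The automaton with a `true`-labelled segment of `n` vertices and a `false`-labelled loop at each
of them. -/
def loopsOnSegment (n : ℕ) (x : Bool) (s t : ℕ) : Prop :=
  if x then t = s + 1 ∧ t < n else t = s ∧ s < n

theorem folded_cyclesOnRay (p : ℕ → ℕ) : FreeGroup.Folded (cyclesOnRay p) where
  target_unique := by
    rintro (_ | _) ⟨i, r⟩ ⟨i₁, r₁⟩ ⟨i₂, r₂⟩ h₁ h₂ <;> simp [cyclesOnRay] at h₁ h₂ ⊢ <;> grind
  source_unique := by
    rintro (_ | _) ⟨i, r⟩ ⟨i₁, r₁⟩ ⟨i₂, r₂⟩ h₁ h₂ <;> simp [cyclesOnRay] at h₁ h₂ ⊢ <;> grind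

theorem folded_loopsOnSegment (n : ℕ) : FreeGroup.Folded (loopsOnSegment n) where
  target_unique := by
    rintro (_ | _) s t t' h₁ h₂ <;> simp [loopsOnSegment] at h₁ h₂ ⊢ <;> omega
  source_unique := by
    rintro (_ | _) s t t' h₁ h₂ <;> simp [loopsOnSegment] at h₁ h₂ ⊢ <;> omega

theorem accepts_cyclesOnRay {p : ℕ → ℕ} {i : ℕ} (hp : 0 < p i) :
    FreeGroup.Accepts (cyclesOnRay p)
      (FreeGroup.of false ^ i * FreeGroup.of true ^ p i * (FreeGroup.of false ^ i)⁻¹)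
      (0, 0) (0, 0) := by
  have hE := folded_cyclesOnRay p
  have hb : FreeGroup.Accepts (cyclesOnRay p) (FreeGroup.of false ^ i) (0, 0) (i, 0) :=
    FreeGroup.Accepts.pow hE (f := fun t => (t, 0)) fun t _ =>
      FreeGroup.Accepts.of (by simp [cyclesOnRay])
  have ha : FreeGroup.Accepts (cyclesOnRay p) (FreeGroup.of true ^ p i) (i, 0) (i, 0) := by
    obtain ⟨q, hq⟩ := Nat.exists_eq_succ_of_ne_zero hp.ne'
    rw [hq, Nat.succ_eq_add_one, pow_succ]
    refine FreeGroup.Accepts.mul hE (t := (i, q)) ?_ (FreeGroup.Accepts.of ?_)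
    · exact FreeGroup.Accepts.pow hE (f := fun t => (i, t)) fun t ht =>
        FreeGroup.Accepts.of (by simp [cyclesOnRay]; omega)
    · simp [cyclesOnRay, hq]
  exact (hb.mul hE ha).mul hE hb.inv

theorem accepts_loopsOnSegment {n i : ℕ} (hi : i < n) :
    FreeGroup.Accepts (loopsOnSegment n)
      (FreeGroup.of true ^ i * FreeGroup.of false * (FreeGroup.of true ^ i)⁻¹) 0 0 := by
  have hE := folded_loopsOnSegment n
  have ha : FreeGroup.Accepts (loopsOnSegment n) (FreeGroup.of true ^ i) 0 i :=
    FreeGroup.Accepts.pow hE (f := fun t => t) fun t _ =>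
      FreeGroup.Accepts.of (by simp [loopsOnSegment]; omega)
  exact (ha.mul hE (FreeGroup.Accepts.of (by simp [loopsOnSegment, hi]))).mul hE ha.inv

/-- A word leading from the origin to a vertex of the product of `cyclesOnRay p` and a segment,
inside a spanning tree. -/
def treeWord (p : ℕ → ℕ) (s : (ℕ × ℕ) × ℕ) : FreeGroup Bool :=
  if s.1.2 ≤ s.2 then
    FreeGroup.of true ^ (s.2 - s.1.2) * FreeGroup.of false ^ s.1.1 * FreeGroup.of true ^ s.1.2
  else
    FreeGroup.of true ^ (s.2 + p s.1.1 - s.1.2) * FreeGroup.of false ^ s.1.1 *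
      (FreeGroup.of true ^ (p s.1.1 - s.1.2))⁻¹

theorem treeWord_mul_mul_inv_mem {p : ℕ → ℕ} {n : ℕ} {C : Subgroup (FreeGroup Bool)}
    (hC : ∀ i j, j + p i < n → gridLoop i j (p i) ∈ C) (x : Bool) (s t : (ℕ × ℕ) × ℕ)
    (h : cyclesOnRay p x s.1 t.1 ∧ loopsOnSegment n x s.2 t.2) :
    treeWord p s * FreeGroup.of x * (treeWord p t)⁻¹ ∈ C := by
  obtain ⟨⟨i, r⟩, j⟩ := s
  obtain ⟨⟨i', r'⟩, j'⟩ := t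
  cases x
  · simp only [cyclesOnRay, loopsOnSegment, Bool.false_eq_true, if_false] at h
    obtain ⟨⟨rfl, rfl, rfl⟩, rfl, -⟩ := h
    simp [treeWord, pow_succ, mul_assoc]
  · simp only [cyclesOnRay, loopsOnSegment, if_true] at h
    obtain ⟨⟨rfl, ⟨rfl, hr⟩ | ⟨rfl, hr⟩⟩, rfl, hj⟩ := h
    · by_cases hrj : r ≤ j
      · simp [treeWord, hrj, pow_succ, mul_assoc]
      · obtain ⟨q, hq⟩ : ∃ q, p i' = r + 1 + q := ⟨p i' - (r + 1), by omega⟩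
        have h₁ : j + (r + 1 + q) - r = j + 1 + q := by omega
        have h₂ : r + 1 + q - r = q + 1 := by omega
        have h₃ : j + 1 + (r + 1 + q) - (r + 1) = j + 1 + q := by omega
        have h₄ : r + 1 + q - (r + 1) = q := by omega
        simp [treeWord, hrj, hq, h₁, h₂, h₃, h₄, pow_succ' _ q, mul_assoc]
    · by_cases hrj : r ≤ j
      · have hmem := hC i' (j - r) (by omega)
        have h₁ : j - r + (r + 1) = j + 1 := by omega
        rw [← hr] at hmem
        simpa [treeWord, hrj, gridLoop, h₁, pow_succ _ r, mul_assoc] using hmem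
      · have h₁ : j + (r + 1) - r = j + 1 := by omega
        simp [treeWord, hrj, ← hr, h₁, mul_assoc]

/-- The indices of the basis: the unit squares with top row `1, …, k`, and the `l` loops in row
`k + 1`. -/
abbrev LoopIndex (n k l : ℕ) : Type := (Fin k × Fin (n - 1)) ⊕ Fin l

/-- The loop with a given index. -/
def basisLoop (n k l : ℕ) : LoopIndex n k l → FreeGroup Bool
  | .inl x => gridLoop (x.1 + 1) x.2 1
  | .inr x => gridLoop (k + 1) x (n - l)

/-- A potential whose holonomies along the loops `basisLoop n k l` are the unit vectors. -/
def loopPotential (n k l : ℕ) (i j : ℤ) : LoopIndex n k l → ℚ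
  | .inl x => if i = x.1 + 1 ∧ (x.2 : ℤ) < j then 1 else 0
  | .inr x => if i = k + 1 ∧ (x : ℤ) < j ∧ ((n - l : ℕ) : ℤ) ∣ j - x then 1 else 0

theorem loopPotential_zero (n k l : ℕ) (j : ℤ) : loopPotential n k l 0 j = 0 := by
  ext (x | x)
  · have : (0 : ℤ) ≠ x.1 + 1 := by omega
    simp [loopPotential, this]
  · have : (0 : ℤ) ≠ k + 1 := by omega
    simp [loopPotential, this]

theorem gridAction_basisLoop {n k l : ℕ} (hnl : l < n) (x : LoopIndex n k l) :
    (gridAction (loopPotential n k l) (basisLoop n k l x) (0, 0, 0)).2.2 = Pi.single x 1 := by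
  classical
  rcases x with ⟨⟨i, hi⟩, ⟨j, hj⟩⟩ | ⟨j, hj⟩
  · rw [basisLoop, gridAction_gridLoop _ (loopPotential_zero n k l)]
    ext (⟨⟨i', hi'⟩, ⟨j', hj'⟩⟩ | ⟨j', hj'⟩)
    · simp only [loopPotential, Pi.sub_apply, Pi.single_apply, Sum.inl.injEq, Prod.mk.injEq,
        Fin.mk.injEq]
      grind
    · simp [loopPotential]
      grind
  · rw [basisLoop, gridAction_gridLoop _ (loopPotential_zero n k l)]
    ext (⟨⟨i', hi'⟩, ⟨j', hj'⟩⟩ | ⟨j', hj'⟩)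
    · simp [loopPotential]
      grind
    · generalize hq : n - l = q at *
      have hdvd : (q : ℤ) ∣ j + q - j' ↔ (q : ℤ) ∣ j - j' := by
        rw [show (j + q - j' : ℤ) = j - j' + q by ring, dvd_add_self_right]
      simp only [loopPotential, hq, hdvd, Pi.sub_apply, Pi.single_apply, Sum.inr.injEq,
        Fin.mk.injEq]
      by_cases hd : (q : ℤ) ∣ j - j'
      · by_cases hjj : j' = j
        · subst hjj
          simp
          omega
        · have : (j' : ℤ) < j + q ↔ (j' : ℤ) < j := by
            refine ⟨fun h => ?_, fun h => by omega⟩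
            by_contra hlt
            have := Int.eq_zero_of_dvd_of_nonneg_of_lt (m := (j' - j : ℤ)) (n := q)
              (by omega) (by omega) (by rw [← dvd_neg]; simpa using hd)
            omega
          simp [hd, this, hjj]
      · have : j' ≠ j := by rintro rfl; simp at hd
        simp [hd, this]

theorem stmt_3 (m n k l : ℕ) (hm : 2 ≤ m) (hn : 1 ≤ n) (hk : k ≤ m - 2) (hl : l ≤ n - 1) :
    let a : FreeGroup Bool := FreeGroup.of true
    let b : FreeGroup Bool := FreeGroup.of false
    let H : Subgroup (FreeGroup Bool) :=
      Subgroup.closure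
        ((fun i : ℕ => b ^ i * a * (b ^ i)⁻¹) '' Set.Iic k ∪
          {b ^ (k + 1) * a ^ (n - l) * (b ^ (k + 1))⁻¹} ∪
          (fun j : ℕ => b ^ j * a ^ n * (b ^ j)⁻¹) '' Set.Icc (k + 2) (m - 1))
    let K : Subgroup (FreeGroup Bool) :=
      Subgroup.closure ((fun i : ℕ => a ^ i * b * (a ^ i)⁻¹) '' Set.Iio n)
    ∃ hI : Group.FG ↥(H ⊓ K), @Group.rank ↥(H ⊓ K) _ hI = k * (n - 1) + l := by
  intro a b H K
  have hHa : ∀ i ≤ k, b ^ i * a ^ 1 * (b ^ i)⁻¹ ∈ H := fun i hi =>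
    Subgroup.subset_closure (.inl (.inl ⟨i, hi, by simp⟩))
  have hHk : b ^ (k + 1) * a ^ (n - l) * (b ^ (k + 1))⁻¹ ∈ H :=
    Subgroup.subset_closure (.inl (.inr rfl))
  have hK : ∀ i j, j < n → a ^ j * b ^ i * (a ^ j)⁻¹ ∈ K := fun i j hj => by
    rw [← conj_pow]
    exact K.pow_mem (Subgroup.subset_closure ⟨j, hj, rfl⟩) i
  have ha (j : ℕ) : a ^ j ∈ H := H.pow_mem (by simpa using hHa 0 (Nat.zero_le k)) j
  have hloopH {i s : ℕ} (j : ℕ) (h : b ^ i * a ^ s * (b ^ i)⁻¹ ∈ H) : gridLoop i j s ∈ H :=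
    H.mul_mem (H.mul_mem (ha j) h) (H.inv_mem (ha _))
  have hloopK {i j s : ℕ} (h : j + s < n) : gridLoop i j s ∈ K := by
    have := K.mul_mem (hK i j (by omega)) (K.inv_mem (hK i (j + s) h))
    convert this using 1
    simp only [gridLoop, a, b, pow_add]
    group
  have hloop (x : LoopIndex n k l) : basisLoop n k l x ∈ H ⊓ K := by
    rcases x with x | x
    · exact ⟨hloopH _ (hHa _ (by omega)), hloopK (by omega)⟩
    · exact ⟨hloopH _ hHk, hloopK (by omega)⟩
  have hle : H ⊓ K ≤ Subgroup.closure (Set.range (basisLoop n k l)) := by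
    rintro w ⟨hwH, hwK⟩
    let p : ℕ → ℕ := fun i => if i ≤ k then 1 else if i = k + 1 then n - l else n
    have hp (i : ℕ) : 0 < p i := by grind
    have hAH : FreeGroup.Accepts (cyclesOnRay p) w (0, 0) (0, 0) := by
      refine FreeGroup.accepts_of_mem_closure (folded_cyclesOnRay p) ?_ hwH
      rintro _ ((⟨i, hi, rfl⟩ | rfl) | ⟨i, hi, rfl⟩)
      · have : p i = 1 := if_pos hi
        simpa [this] using accepts_cyclesOnRay (hp i)
      · have : p (k + 1) = n - l := by simp [p]
        simpa [this] using accepts_cyclesOnRay (hp (k + 1))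
      · have : p i = n := by grind
        simpa [this] using accepts_cyclesOnRay (hp i)
    have hAK : FreeGroup.Accepts (loopsOnSegment n) w 0 0 := by
      refine FreeGroup.accepts_of_mem_closure (folded_loopsOnSegment n) ?_ hwK
      rintro _ ⟨i, hi, rfl⟩
      exact accepts_loopsOnSegment hi
    have hC (i j : ℕ) (h : j + p i < n) :
        gridLoop i j (p i) ∈ Subgroup.closure (Set.range (basisLoop n k l)) := by
      rcases Nat.eq_zero_or_pos i with rfl | hi
      · simp [gridLoop, pow_add]
      by_cases hik : i ≤ k
      · have hpi : p i = 1 := if_pos hik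
        rw [hpi] at h ⊢
        refine Subgroup.subset_closure
          ⟨.inl (⟨i - 1, by omega⟩, ⟨j, by omega⟩), ?_⟩
        simp [basisLoop, Nat.sub_add_cancel hi]
      · have hik' : i = k + 1 := by grind
        have hpi : p i = n - l := by grind
        rw [hpi] at h ⊢
        exact Subgroup.subset_closure ⟨.inr ⟨j, by omega⟩, by simp [basisLoop, hik']⟩
    simpa [treeWord] using (hAH.prod hAK).mul_mul_inv_mem (treeWord_mul_mul_inv_mem hC)
  have heq : H ⊓ K = Subgroup.closure (Set.range (basisLoop n k l)) :=
    le_antisymm hle ((Subgroup.closure_le _).2 (by rintro _ ⟨x, rfl⟩; exact hloop x))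
  have hcard : Fintype.card (LoopIndex n k l) = k * (n - 1) + l := by simp
  have hFG : Group.FG ↥(H ⊓ K) := by
    rw [heq]
    infer_instance
  refine ⟨hFG, le_antisymm ?_ ?_⟩
  · rw [Subgroup.rank_congr heq, ← hcard, ← Nat.card_eq_fintype_card]
    exact (Subgroup.rank_closure_finite_le_nat_card _).trans (Finite.card_range_le _)
  · have hker (x : Bool) : H ⊓ K ≤ (expSum x).ker := by
      cases x
      · refine inf_le_left.trans ((Subgroup.closure_le _).2 ?_)
        rintro _ ((⟨i, hi, rfl⟩ | rfl) | ⟨i, hi, rfl⟩) <;> simp [a, b, expSum]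
      · refine inf_le_right.trans ((Subgroup.closure_le _).2 ?_)
        rintro _ ⟨i, hi, rfl⟩
        simp [a, b, expSum]
    have hspan := Module.finrank_le_rank_of_span_range_eq_top (R := ℚ)
      (gridHolonomy (loopPotential n k l) (H ⊓ K) hker) (by
        rw [eq_top_iff, ← (Pi.basisFun ℚ (LoopIndex n k l)).span_eq]
        refine Submodule.span_mono ?_
        rintro _ ⟨x, rfl⟩
        refine ⟨⟨basisLoop n k l x, hloop x⟩, ?_⟩
        simpa [gridHolonomy] using gridAction_basisLoop (by omega) x)
    rwa [Module.finrank_fintype_fun_eq_card, hcard] at hspan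
end

section
/- (Hanna Neumann bound, as used in the paper) If H and K are nontrivial finitely generated subgroups of a free group F with ranks m and n respectively, then rank(H ∩ K) − 1 ≤ 2(m−1)(n−1). -/
namespace HannaNeumann

open FreeGroup (of mk IsReduced IsCyclicallyReduced invRev reduceCyclically)

section Cocycle

variable {ι X : Type*} [MulAction (FreeGroup ι) X]

/-- The permutation of `X × ((X × ι) →₀ ℚ)` which moves the first coordinate along the edge
labelled `i` and records that edge in the second coordinate. -/
noncomputable def edgePerm (X : Type*) [MulAction (FreeGroup ι) X] (i : ι) :
    Equiv.Perm (X × ((X × ι) →₀ ℚ)) where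
  toFun p := (of i • p.1, p.2 + Finsupp.single (p.1, i) 1)
  invFun p := ((of i)⁻¹ • p.1, p.2 - Finsupp.single ((of i)⁻¹ • p.1, i) 1)
  left_inv p := by simp
  right_inv p := by simp

/-- The chain of edges traversed by (any word representing) `g`, starting at `x`. -/
noncomputable def chain (g : FreeGroup ι) (x : X) : (X × ι) →₀ ℚ :=
  (FreeGroup.lift (edgePerm X) g (x, 0)).2

theorem lift_edgePerm_apply (g : FreeGroup ι) (x : X) (t : (X × ι) →₀ ℚ) :
    FreeGroup.lift (edgePerm X) g (x, t) = (g • x, t + chain g x) := by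
  induction g using FreeGroup.induction_on generalizing x t with
  | C1 => simp [chain]
  | of i => simp [chain, edgePerm]
  | inv_of i _ =>
    simp [chain, edgePerm, Equiv.Perm.inv_def, sub_eq_add_neg]
  | mul g h hg hh =>
    have key : chain (g * h) x = chain h x + chain g (h • x) := by
      rw [chain, map_mul, Equiv.Perm.mul_apply, hh, hg, zero_add]
    rw [map_mul, Equiv.Perm.mul_apply, hh, hg, key, mul_smul, add_assoc]

theorem chain_mul (g h : FreeGroup ι) (x : X) :
    chain (g * h) x = chain h x + chain g (h • x) := by
  rw [chain, map_mul, Equiv.Perm.mul_apply, lift_edgePerm_apply, lift_edgePerm_apply, zero_add]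

theorem chain_of (i : ι) (x : X) : chain (of i) x = Finsupp.single (x, i) 1 := by
  simp [chain, edgePerm]

theorem chain_one (x : X) : chain (1 : FreeGroup ι) x = 0 := by
  simp [chain]

end Cocycle

/-- A finite subgraph of the Schreier graph of a subgroup generated by `G` has Euler
characteristic at least `1 - |G|`. -/
theorem card_edges_add_one_le {ι : Type*} {H : Subgroup (FreeGroup ι)}
    (G : Finset (FreeGroup ι)) (hG : Subgroup.closure (G : Set (FreeGroup ι)) = H)
    (V : Finset (FreeGroup ι ⧸ H)) (hV : V.Nonempty) (E : Finset ((FreeGroup ι ⧸ H) × ι))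
    (hE : ∀ e ∈ E, e.1 ∈ V ∧ of e.2 • e.1 ∈ V) :
    E.card + 1 ≤ V.card + G.card := by
  classical
  obtain ⟨v₀, hv₀⟩ := hV
  let x₀ : FreeGroup ι ⧸ H := ((1 : FreeGroup ι) : FreeGroup ι ⧸ H)
  have smul_x₀ (g : FreeGroup ι) : g • x₀ = (g : FreeGroup ι ⧸ H) := by
    simp [x₀]
  have fix (h : FreeGroup ι) (hh : h ∈ H) : h • x₀ = x₀ := by
    rw [smul_x₀]; simpa [x₀, QuotientGroup.eq] using hh
  let P : (FreeGroup ι ⧸ H) → (((FreeGroup ι ⧸ H) × ι) →₀ ℚ) := fun x ↦ chain x.out x₀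
  let B := G.image (fun g ↦ chain g x₀) ∪ (V.erase v₀).image (fun v ↦ P v - P v₀)
  have hB : B.card + 1 ≤ V.card + G.card := by
    have h1 := Finset.card_union_le (G.image (fun g ↦ chain g x₀))
      ((V.erase v₀).image (fun v ↦ P v - P v₀))
    have h2 := Finset.card_image_le (s := G) (f := fun g ↦ chain g x₀)
    have h3 := Finset.card_image_le (s := V.erase v₀) (f := fun v ↦ P v - P v₀)
    have h4 := Finset.card_erase_add_one hv₀
    lia
  let R := Submodule.span ℚ (B : Set (((FreeGroup ι ⧸ H) × ι) →₀ ℚ))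
  have hR (h : FreeGroup ι) (hh : h ∈ H) : chain h x₀ ∈ R := by
    rw [← hG] at hh
    induction hh using Subgroup.closure_induction with
    | mem g hg =>
      exact Submodule.subset_span (by simp only [B]; push_cast; exact .inl ⟨g, hg, rfl⟩)
    | one => rw [chain_one]; exact R.zero_mem
    | mul g h _ hh ihg ihh =>
      rw [chain_mul, fix h (hG ▸ hh)]
      exact R.add_mem ihh ihg
    | inv g hg ih =>
      have := chain_mul g⁻¹ g x₀
      rw [inv_mul_cancel, chain_one, fix g (hG ▸ hg)] at this
      rw [eq_neg_of_add_eq_zero_right this.symm]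
      exact R.neg_mem ih
  have hP (v) (hv : v ∈ V) : P v - P v₀ ∈ R := by
    by_cases h : v = v₀
    · rw [h, sub_self]; exact R.zero_mem
    · refine Submodule.subset_span ?_
      simp only [B]; push_cast
      exact .inr ⟨v, by simp [h, hv], rfl⟩
  have hsame (g g' : FreeGroup ι) (h : g • x₀ = g' • x₀) : chain g x₀ - chain g' x₀ ∈ R := by
    rw [smul_x₀, smul_x₀, eq_comm, QuotientGroup.eq] at h
    have := chain_mul g' (g'⁻¹ * g) x₀
    rw [mul_inv_cancel_left, fix _ h] at this
    rw [this, add_sub_cancel_right]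
    exact hR _ h
  have hout (x : FreeGroup ι ⧸ H) : x.out • x₀ = x := by rw [smul_x₀]; simp
  have hedge (e) (he : e ∈ E) : Finsupp.single e (1 : ℚ) ∈ R := by
    obtain ⟨h1, h2⟩ := hE e he
    have h3 := hsame (of e.2 * e.1.out) (of e.2 • e.1).out (by rw [hout, mul_smul, hout])
    rw [chain_mul, hout, chain_of] at h3
    have h4 : Finsupp.single e (1 : ℚ) = (P e.1 + Finsupp.single e 1 - P (of e.2 • e.1))
        + ((P (of e.2 • e.1) - P v₀) - (P e.1 - P v₀)) := by abel
    rw [h4]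
    exact R.add_mem h3 (R.sub_mem (hP _ h2) (hP _ h1))
  have hli : LinearIndependent ℚ (fun e : E ↦ Finsupp.single (e : (FreeGroup ι ⧸ H) × ι) (1 : ℚ)) :=
    (Finsupp.linearIndependent_single_one ℚ _).comp _ Subtype.val_injective
  have := linearIndependent_le_span_aux' _ hli (B : Set (((FreeGroup ι ⧸ H) × ι) →₀ ℚ))
    (by rintro _ ⟨e, rfl⟩; exact hedge e e.2)
  simp only [Fintype.card_coe, Finset.coe_sort_coe] at this
  lia


section Darts

variable {ι X : Type*} [MulAction (FreeGroup ι) X]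

/-- A dart `(x, ℓ)` of the Schreier graph of `X` leads from `x` to `dartEnd (x, ℓ)`. -/
def dartEnd (d : X × (ι × Bool)) : X := mk [d.2] • d.1

/-- The dart `d` traversed backwards. -/
def dartInv (d : X × (ι × Bool)) : X × (ι × Bool) := (dartEnd d, (d.2.1, !d.2.2))

theorem mk_flip (ℓ : ι × Bool) : mk [(ℓ.1, !ℓ.2)] = (mk [ℓ])⁻¹ := by
  simp [FreeGroup.inv_mk, invRev]

@[simp]
theorem dartEnd_dartInv (d : X × (ι × Bool)) : dartEnd (dartInv d) = d.1 := by
  rw [dartEnd, dartInv, mk_flip, dartEnd, inv_smul_smul]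

@[simp]
theorem dartInv_fst (d : X × (ι × Bool)) : (dartInv d).1 = dartEnd d := rfl

@[simp]
theorem dartInv_dartInv (d : X × (ι × Bool)) : dartInv (dartInv d) = d :=
  Prod.ext (dartEnd_dartInv d) (by simp [dartInv])

theorem mk_nil_smul (x : X) : mk ([] : List (ι × Bool)) • x = x := one_smul _ x

theorem mk_cons_smul (ℓ : ι × Bool) (w : List (ι × Bool)) (x : X) :
    mk (ℓ :: w) • x = mk [ℓ] • mk w • x := by
  rw [← mul_smul, FreeGroup.mul_mk]; rfl

/-- The word `w`, read from right to left starting at `x`, only uses darts in `S`. -/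
def Reads (S : Set (X × (ι × Bool))) (x : X) : List (ι × Bool) → Prop
  | [] => True
  | ℓ :: w => (mk w • x, ℓ) ∈ S ∧ Reads S x w

theorem reads_append {S : Set (X × (ι × Bool))} {x : X} (u w : List (ι × Bool)) :
    Reads S x (u ++ w) ↔ Reads S (mk w • x) u ∧ Reads S x w := by
  induction u with
  | nil => simp [Reads]
  | cons ℓ u ih =>
    rw [List.cons_append, Reads, Reads, ih, ← FreeGroup.mul_mk, mul_smul, and_assoc]

theorem Reads.mono {S S' : Set (X × (ι × Bool))} (h : S ⊆ S') {x : X} {w : List (ι × Bool)}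
    (hw : Reads S x w) : Reads S' x w := by
  induction w with
  | nil => trivial
  | cons ℓ w ih => exact ⟨h hw.1, ih hw.2⟩

theorem Reads.reduce [DecidableEq ι] {S : Set (X × (ι × Bool))} {x : X} {w : List (ι × Bool)}
    (hw : Reads S x w) : Reads S x (FreeGroup.reduce w) := by
  have key := FreeGroup.reduce.red (L := w)
  generalize FreeGroup.reduce w = w' at key
  induction key with
  | refl => exact hw
  | tail _ hstep ih =>
    obtain @⟨a, b, i, c⟩ := hstep
    have h := FreeGroup.Red.Step.not (L₁ := []) (L₂ := b) (x := i) (b := c)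
    rw [reads_append] at ih ⊢
    have he : mk ((i, c) :: (i, !c) :: b) = mk b := Quot.sound h
    rw [he] at ih
    exact ⟨ih.1, ih.2.2.2⟩

theorem Reads.invRev {S : Set (X × (ι × Bool))} (hS : ∀ d ∈ S, dartInv d ∈ S) {x : X}
    {w : List (ι × Bool)} (hw : Reads S x w) : Reads S (mk w • x) (invRev w) := by
  induction w with
  | nil => trivial
  | cons ℓ w ih =>
    rw [FreeGroup.invRev_cons, reads_append, ← FreeGroup.inv_mk, mk_cons_smul, inv_smul_smul]
    refine ⟨ih hw.2, ?_, trivial⟩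
    erw [mk_nil_smul]
    exact hS _ hw.1

/-- The darts traversed by `w` when started at `x`. -/
def dartsOf (x : X) : List (ι × Bool) → Set (X × (ι × Bool))
  | [] => ∅
  | ℓ :: w => insert (mk w • x, ℓ) (dartsOf x w)

theorem dartsOf_finite (x : X) (w : List (ι × Bool)) : (dartsOf x w).Finite := by
  induction w with
  | nil => exact Set.finite_empty
  | cons ℓ w ih => exact ih.insert _

theorem reads_dartsOf (x : X) (w : List (ι × Bool)) : Reads (dartsOf x w) x w := by
  induction w with
  | nil => trivial
  | cons ℓ w ih => exact ⟨Set.mem_insert _ _, ih.mono (Set.subset_insert _ _)⟩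

theorem Reads.exists_exit {S : Set (X × (ι × Bool))} {x : X} {w : List (ι × Bool)}
    (hw : Reads S x w) {U : Set X} (hx : x ∈ U) (hwx : mk w • x ∉ U) :
    ∃ d ∈ S, d.1 ∈ U ∧ dartEnd d ∉ U := by
  induction w with
  | nil => exact absurd hx (by rwa [mk_nil_smul] at hwx)
  | cons ℓ w ih =>
    by_cases h : mk w • x ∈ U
    · exact ⟨_, hw.1, h, by rwa [mk_cons_smul] at hwx⟩
    · exact ih hw.2 h

/-- A connected finite graph has spanning trees; here `A` is the set of positively oriented edges
of a tree with vertex set `U`, and `T u` is the label of the tree path from `x₀` to `u`. -/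
theorem exists_tree [DecidableEq X] (D : Finset (X × (ι × Bool))) (hD : ∀ d ∈ D, dartInv d ∈ D)
    (V : Finset X) (hDV : ∀ d ∈ D, d.1 ∈ V) (x₀ : X) (hx₀ : x₀ ∈ V)
    (hconn : ∀ v ∈ V, ∃ w, mk w • x₀ = v ∧ Reads (D : Set (X × (ι × Bool))) x₀ w)
    (k : ℕ) (hk : k + 1 ≤ V.card) :
    ∃ U ⊆ V, x₀ ∈ U ∧ U.card = k + 1 ∧ ∃ T : X → FreeGroup ι, T x₀ = 1 ∧ (∀ u ∈ U, T u • x₀ = u) ∧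
      ∃ A ⊆ D.filter (fun d ↦ d.2.2 = true), A.card = k ∧
        ∀ d ∈ A, d.1 ∈ U ∧ dartEnd d ∈ U ∧ T (dartEnd d) = mk [d.2] * T d.1 := by
  classical
  induction k with
  | zero =>
    refine ⟨{x₀}, by simpa using hx₀, by simp, by simp, fun _ ↦ 1, rfl, by simp, ∅, by simp,
      rfl, by simp⟩
  | succ k ih =>
    obtain ⟨U, hUV, hxU, hUc, T, hT1, hTU, A, hAD, hAc, hA⟩ := ih (by lia)
    obtain ⟨v, hvV, hvU⟩ : ∃ v ∈ V, v ∉ U := by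
      by_contra! h
      have := Finset.card_le_card (show V ⊆ U from h)
      lia
    obtain ⟨w, rfl, hw⟩ := hconn v hvV
    obtain ⟨d, hdD, hdU, heU⟩ := hw.exists_exit (U := (U : Set X)) hxU hvU
    simp only [Finset.mem_coe] at hdD hdU heU
    have hne {u} (hu : u ∈ U) : u ≠ dartEnd d := fun h ↦ heU (h ▸ hu)
    let T' := Function.update T (dartEnd d) (mk [d.2] * T d.1)
    have hT' {u} (hu : u ∈ U) : T' u = T u := Function.update_of_ne (hne hu) _ _
    have hT'e : T' (dartEnd d) = mk [d.2] * T d.1 := Function.update_self _ _ _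
    let e := if d.2.2 = true then d else dartInv d
    have he : e ∈ D.filter (fun d ↦ d.2.2 = true) ∧ (e.1 = dartEnd d ∨ dartEnd e = dartEnd d) ∧
        e.1 ∈ insert (dartEnd d) U ∧ dartEnd e ∈ insert (dartEnd d) U ∧
        T' (dartEnd e) = mk [e.2] * T' e.1 := by
      by_cases h : d.2.2 = true
      · have : e = d := if_pos h
        rw [this, hT'e, hT' hdU]
        simp [hdD, h, hdU]
      · have : e = dartInv d := if_neg h
        rw [this, dartEnd_dartInv, dartInv_fst, hT'e, hT' hdU]
        have h2 : mk [(dartInv d).2] = (mk [d.2])⁻¹ := mk_flip d.2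
        rw [h2]
        exact ⟨Finset.mem_filter.2 ⟨hD d hdD, by simpa [dartInv] using h⟩, .inl rfl,
          Finset.mem_insert_self _ _, Finset.mem_insert_of_mem hdU, by rw [inv_mul_cancel_left]⟩
    refine ⟨insert (dartEnd d) U, ?_, Finset.mem_insert_of_mem hxU, ?_, T', ?_, ?_,
      insert e A, ?_, ?_, ?_⟩
    · exact Finset.insert_subset (by simpa using hDV _ (hD d hdD)) hUV
    · rw [Finset.card_insert_of_notMem heU, hUc]
    · rw [hT' hxU, hT1]
    · intro u hu
      rcases Finset.mem_insert.1 hu with rfl | hu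
      · rw [hT'e, mul_smul, hTU _ hdU]; rfl
      · rw [hT' hu, hTU u hu]
    · exact Finset.insert_subset he.1 hAD
    · rw [Finset.card_insert_of_notMem, hAc]
      intro heA
      rcases he.2.1 with h | h
      · exact hne (hA e heA).1 h
      · exact hne (hA e heA).2.1 h
    · intro a ha
      rcases Finset.mem_insert.1 ha with rfl | ha
      · exact he.2.2
      · obtain ⟨h1, h2, h3⟩ := hA a ha
        exact ⟨Finset.mem_insert_of_mem h1, Finset.mem_insert_of_mem h2,
          by rw [hT' h1, hT' h2, h3]⟩

/-- The stabilizer of a vertex of a connected finite graph is generated by at most `1 - χ`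
elements, provided that all its elements are read in the graph. -/
theorem exists_generators [DecidableEq X] (D : Finset (X × (ι × Bool)))
    (hD : ∀ d ∈ D, dartInv d ∈ D)
    (V : Finset X) (hDV : ∀ d ∈ D, d.1 ∈ V) (x₀ : X) (hx₀ : x₀ ∈ V)
    (hconn : ∀ v ∈ V, ∃ w, mk w • x₀ = v ∧ Reads (D : Set (X × (ι × Bool))) x₀ w)
    (L : Subgroup (FreeGroup ι)) (hL : ∀ g, g ∈ L ↔ g • x₀ = x₀)
    (hread : ∀ g ∈ L, ∃ w, mk w = g ∧ Reads (D : Set (X × (ι × Bool))) x₀ w) :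
    ∃ G : Finset (FreeGroup ι), Subgroup.closure (G : Set (FreeGroup ι)) = L ∧
      G.card + V.card ≤ (D.filter (fun d ↦ d.2.2 = true)).card + 1 := by
  classical
  have hVpos : 0 < V.card := Finset.card_pos.2 ⟨_, hx₀⟩
  obtain ⟨U, hUV, -, hUc, T, hT1, hTU, A, hAD, hAc, hA⟩ :=
    exists_tree D hD V hDV x₀ hx₀ hconn (V.card - 1) (by lia)
  obtain rfl : U = V := Finset.eq_of_subset_of_card_le hUV (by lia)
  let γ : X × (ι × Bool) → FreeGroup ι := fun d ↦ (T (dartEnd d))⁻¹ * (mk [d.2] * T d.1)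
  let G := (D.filter (fun d ↦ d.2.2 = true) \ A).image γ
  refine ⟨G, le_antisymm ?_ ?_, ?_⟩
  · rw [Subgroup.closure_le]
    intro g hg
    obtain ⟨d, hd, rfl⟩ := Finset.mem_image.1 (Finset.mem_coe.1 hg)
    have hdD : d ∈ D := (Finset.mem_filter.1 (Finset.mem_sdiff.1 hd).1).1
    have h1 := hTU _ (hDV _ hdD)
    have h2 := hTU _ (hDV _ (hD _ hdD))
    rw [dartInv_fst] at h2
    rw [SetLike.mem_coe, hL, mul_smul, mul_smul, h1, inv_smul_eq_iff, h2]
    rfl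
  · have hpos (d) (hd : d ∈ D) (hd2 : d.2.2 = true) : γ d ∈ Subgroup.closure (G : Set _) := by
      by_cases hdA : d ∈ A
      · have : γ d = 1 := by simp only [γ]; rw [(hA d hdA).2.2, inv_mul_cancel]
        rw [this]; exact one_mem _
      · exact Subgroup.subset_closure (Finset.mem_coe.2 (Finset.mem_image_of_mem _ (by simp [*])))
    have hall (d) (hd : d ∈ D) : γ d ∈ Subgroup.closure (G : Set _) := by
      by_cases hd2 : d.2.2 = true
      · exact hpos d hd hd2
      · have h := hpos _ (hD d hd) (by simpa [dartInv] using hd2)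
        have h2 : mk [(dartInv d).2] = (mk [d.2])⁻¹ := mk_flip d.2
        have : γ d = (γ (dartInv d))⁻¹ := by
          simp only [γ, dartEnd_dartInv, dartInv_fst, h2]; group
        rw [this]; exact inv_mem h
    have htel (w) (hw : Reads (D : Set (X × (ι × Bool))) x₀ w) :
        (T (mk w • x₀))⁻¹ * mk w ∈ Subgroup.closure (G : Set (FreeGroup ι)) := by
      induction w with
      | nil =>
        have h1 : mk ([] : List (ι × Bool)) = 1 := rfl
        rw [h1, one_smul, hT1]; simp
      | cons ℓ w ih =>
        have h := mul_mem (hall _ hw.1) (ih hw.2)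
        have h1 : mk (ℓ :: w) = mk [ℓ] * mk w := by rw [FreeGroup.mul_mk]; rfl
        rw [mk_cons_smul, h1]
        simp only [γ, dartEnd] at h
        convert h using 1
        group
    intro g hg
    obtain ⟨w, rfl, hw⟩ := hread g hg
    simpa [(hL _).1 hg, hT1] using htel w hw
  · have h1 := Finset.card_image_le (s := D.filter (fun d ↦ d.2.2 = true) \ A) (f := γ)
    rw [Finset.card_sdiff_of_subset hAD] at h1
    have h2 := Finset.card_le_card hAD
    simp only [G]
    lia

theorem card_eq_two_mul_card_filter (D : Finset (X × (ι × Bool))) (hD : ∀ d ∈ D, dartInv d ∈ D) :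
    D.card = 2 * (D.filter (fun d ↦ d.2.2 = true)).card := by
  classical
  have h := Finset.card_filter_add_card_filter_not (s := D) (fun d ↦ d.2.2 = true)
  have h2 : (D.filter (fun d ↦ ¬ d.2.2 = true)).card = (D.filter (fun d ↦ d.2.2 = true)).card := by
    refine Finset.card_bij' (fun d _ ↦ dartInv d) (fun d _ ↦ dartInv d) ?_ ?_ ?_ ?_
    · intro d hd
      rw [Finset.mem_filter] at hd ⊢
      exact ⟨hD d hd.1, by simpa [dartInv] using hd.2⟩
    · intro d hd
      rw [Finset.mem_filter] at hd ⊢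
      exact ⟨hD d hd.1, by simpa [dartInv] using hd.2⟩
    · simp
    · simp
  lia

end Darts

section Core

variable {ι : Type*}

theorem smul_base {H : Subgroup (FreeGroup ι)} (g : FreeGroup ι) :
    g • ((1 : FreeGroup ι) : FreeGroup ι ⧸ H) = (g : FreeGroup ι ⧸ H) := by
  simp

theorem smul_base_eq_iff {H : Subgroup (FreeGroup ι)} (g : FreeGroup ι) :
    g • ((1 : FreeGroup ι) : FreeGroup ι ⧸ H) = ((1 : FreeGroup ι) : FreeGroup ι ⧸ H) ↔ g ∈ H := by
  rw [smul_base, eq_comm, QuotientGroup.eq, inv_one, one_mul]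

theorem isReduced_invRev {w : List (ι × Bool)} (hw : IsReduced w) : IsReduced (invRev w) := by
  classical
  rw [FreeGroup.isReduced_iff_reduce_eq, FreeGroup.reduce_invRev, hw.reduce_eq]

/-- The darts of the Schreier graph of `H` traversed by reduced words representing elements
of `H`. -/
def coreDarts (H : Subgroup (FreeGroup ι)) : Set ((FreeGroup ι ⧸ H) × (ι × Bool)) :=
  {d | ∃ a b, IsReduced (a ++ d.2 :: b) ∧ mk (a ++ d.2 :: b) ∈ H ∧
    ((mk b : FreeGroup ι) : FreeGroup ι ⧸ H) = d.1}

theorem dartInv_mem_coreDarts {H : Subgroup (FreeGroup ι)} {d : (FreeGroup ι ⧸ H) × (ι × Bool)}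
    (hd : d ∈ coreDarts H) : dartInv d ∈ coreDarts H := by
  obtain ⟨a, b, h1, h2, h3⟩ := hd
  have key : invRev (a ++ d.2 :: b) = invRev b ++ (d.2.1, !d.2.2) :: invRev a := by
    simp [invRev]
  refine ⟨invRev b, invRev a, ?_, ?_, ?_⟩
  · exact key ▸ isReduced_invRev h1
  · change mk (invRev b ++ (d.2.1, !d.2.2) :: invRev a) ∈ H
    rw [← key, ← FreeGroup.inv_mk]
    exact inv_mem h2
  · rw [dartInv_fst, dartEnd, ← h3, ← smul_base, ← smul_base (mk b), ← mk_cons_smul,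
      ← FreeGroup.inv_mk, inv_smul_eq_iff, ← mul_smul, FreeGroup.mul_mk, eq_comm,
      smul_base_eq_iff]
    exact h2

theorem reads_coreDarts {H : Subgroup (FreeGroup ι)} (a b : List (ι × Bool))
    (h : IsReduced (a ++ b)) (hH : mk (a ++ b) ∈ H) :
    Reads (coreDarts H) ((1 : FreeGroup ι) : FreeGroup ι ⧸ H) b := by
  induction b generalizing a with
  | nil => trivial
  | cons ℓ b ih =>
    refine ⟨⟨a, b, h, hH, (smul_base _).symm⟩, ih (a ++ [ℓ]) ?_ ?_⟩ <;>
    simpa using ‹_›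

theorem coreDarts_finite {H : Subgroup (FreeGroup ι)} (G : Finset (FreeGroup ι))
    (hG : Subgroup.closure (G : Set (FreeGroup ι)) = H) : (coreDarts H).Finite := by
  classical
  let x₀ : FreeGroup ι ⧸ H := ((1 : FreeGroup ι) : FreeGroup ι ⧸ H)
  let S₀ : Set ((FreeGroup ι ⧸ H) × (ι × Bool)) := ⋃ g ∈ G, dartsOf x₀ g.toWord
  let S := S₀ ∪ dartInv '' S₀
  have hS₀ : S₀.Finite := G.finite_toSet.biUnion fun g _ ↦ dartsOf_finite x₀ g.toWord
  have hS : S.Finite := hS₀.union (hS₀.image _)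
  have hsymm : ∀ d ∈ S, dartInv d ∈ S := by
    rintro d (hd | ⟨d, hd, rfl⟩)
    · exact .inr ⟨d, hd, rfl⟩
    · rw [dartInv_dartInv]; exact .inl hd
  have hread (h : FreeGroup ι) (hh : h ∈ H) : ∃ w, mk w = h ∧ Reads S x₀ w := by
    rw [← hG] at hh
    induction hh using Subgroup.closure_induction with
    | mem g hg =>
      refine ⟨g.toWord, FreeGroup.mk_toWord, (reads_dartsOf x₀ _).mono ?_⟩
      exact (Set.subset_biUnion_of_mem (u := fun g ↦ dartsOf x₀ (FreeGroup.toWord g)) hg).trans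
        Set.subset_union_left
    | one => exact ⟨[], rfl, trivial⟩
    | mul g h _ hh ihg ihh =>
      obtain ⟨u, rfl, hu⟩ := ihg
      obtain ⟨w, rfl, hw⟩ := ihh
      refine ⟨u ++ w, FreeGroup.mul_mk.symm, (reads_append u w).2 ⟨?_, hw⟩⟩
      rwa [(smul_base_eq_iff _).2 (hG ▸ hh)]
    | inv g hg ih =>
      obtain ⟨u, rfl, hu⟩ := ih
      refine ⟨invRev u, FreeGroup.inv_mk.symm, ?_⟩
      have := hu.invRev hsymm
      rwa [(smul_base_eq_iff _).2 (hG ▸ hg)] at this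
  refine hS.subset ?_
  rintro ⟨x, ℓ⟩ ⟨a, b, h1, h2, h3⟩
  obtain ⟨w, hw, hwS⟩ := hread _ h2
  have := hwS.reduce
  rw [FreeGroup.reduce.sound hw, h1.reduce_eq, reads_append] at this
  have := this.2.1
  rw [smul_base, h3] at this
  exact this

theorem exists_ne_mem_coreDarts {H : Subgroup (FreeGroup ι)} {w : List (ι × Bool)}
    (hw : IsCyclicallyReduced w) (hw0 : w ≠ []) (hwH : mk w ∈ H) (x : FreeGroup ι ⧸ H)
    (hx : x = ((1 : FreeGroup ι) : FreeGroup ι ⧸ H) ∨ ∃ d ∈ coreDarts H, d.1 = x) :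
    ∃ d ∈ coreDarts H, ∃ d' ∈ coreDarts H, d.1 = x ∧ d'.1 = x ∧ d ≠ d' := by
  have hbase : ∃ d ∈ coreDarts H, ∃ d' ∈ coreDarts H,
      d.1 = ((1 : FreeGroup ι) : FreeGroup ι ⧸ H) ∧
      d'.1 = ((1 : FreeGroup ι) : FreeGroup ι ⧸ H) ∧ d ≠ d' := by
    let x₀ : FreeGroup ι ⧸ H := ((1 : FreeGroup ι) : FreeGroup ι ⧸ H)
    obtain ⟨ℓ, hℓ⟩ : ∃ ℓ, ℓ ∈ w.getLast? := ⟨w.getLast hw0, List.getLast?_eq_some_getLast hw0⟩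
    obtain ⟨a, rfl⟩ := List.getLast?_eq_some_iff.1 hℓ
    have h1 : (x₀, ℓ) ∈ coreDarts H := ⟨a, [], hw.1, hwH, rfl⟩
    obtain ⟨f, hf⟩ : ∃ f, f ∈ (a ++ [ℓ]).head? := ⟨_, List.head?_eq_some_head hw0⟩
    obtain ⟨t, ht⟩ := List.head?_eq_some_iff.1 hf
    have h2 : (((mk t : FreeGroup ι) : FreeGroup ι ⧸ H), f) ∈ coreDarts H :=
      ⟨[], t, by rw [List.nil_append, ← ht]; exact hw.1,
        by rw [List.nil_append, ← ht]; exact hwH, rfl⟩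
    refine ⟨_, h1, _, dartInv_mem_coreDarts h2, rfl, ?_, ?_⟩
    · rw [dartInv_fst, dartEnd, ← smul_base (mk t), ← mk_cons_smul, ← ht, smul_base_eq_iff]
      exact hwH
    · intro h
      have h3 := congrArg Prod.snd h
      simp only [dartInv] at h3
      have h4 := hw.2 _ hℓ _ hf (by rw [h3])
      rw [h3] at h4
      simp at h4
  rcases hx with rfl | ⟨d, hd, rfl⟩
  · exact hbase
  · obtain ⟨a, b, h1, h2, h3⟩ := id hd
    cases b with
    | nil =>
      rw [← h3]
      exact hbase
    | cons f b =>
      have h4 : (((mk b : FreeGroup ι) : FreeGroup ι ⧸ H), f) ∈ coreDarts H :=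
        ⟨a ++ [d.2], b, by simpa using h1, by simpa using h2, rfl⟩
      refine ⟨d, hd, _, dartInv_mem_coreDarts h4, rfl, ?_, ?_⟩
      · rw [dartInv_fst, dartEnd, ← h3, ← smul_base (mk b), ← mk_cons_smul, smul_base]
      · intro h
        have h5 := congrArg Prod.snd h
        simp only [dartInv] at h5
        have h6 : IsReduced (d.2 :: f :: b) := h1.infix ⟨a, [], by simp⟩
        have h7 := (FreeGroup.isReduced_cons_cons.1 h6).1 (by rw [h5])
        rw [h5] at h7
        simp at h7

end Core

section Degree

variable {ι : Type*}

/-- The degree of `x` in a finite graph given by its set of darts. -/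
def deg {X : Type*} [DecidableEq X] (D : Finset (X × (ι × Bool))) (x : X) : ℕ :=
  (D.filter fun d ↦ d.1 = x).card

theorem sum_deg_sub_two {X : Type*} [MulAction (FreeGroup ι) X] [DecidableEq X]
    (D : Finset (X × (ι × Bool))) (hD : ∀ d ∈ D, dartInv d ∈ D) (V : Finset X)
    (hDV : ∀ d ∈ D, d.1 ∈ V) :
    ∑ v ∈ V, ((deg D v : ℤ) - 2) =
      2 * ((D.filter (fun d ↦ d.2.2 = true)).card - V.card) := by
  have h1 : D.card = ∑ v ∈ V, deg D v := Finset.card_eq_sum_card_fiberwise hDV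
  have h2 := card_eq_two_mul_card_filter D hD
  rw [Finset.sum_sub_distrib, ← Nat.cast_sum, ← h1, h2]
  simp
  ring

theorem sum_deg_sub_two_le {H : Subgroup (FreeGroup ι)} [DecidableEq (FreeGroup ι ⧸ H)]
    (G : Finset (FreeGroup ι)) (hG : Subgroup.closure (G : Set (FreeGroup ι)) = H)
    (D : Finset ((FreeGroup ι ⧸ H) × (ι × Bool))) (hD : ∀ d ∈ D, dartInv d ∈ D)
    (V : Finset (FreeGroup ι ⧸ H)) (hV : V.Nonempty) (hDV : ∀ d ∈ D, d.1 ∈ V) :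
    ∑ v ∈ V, ((deg D v : ℤ) - 2) ≤ 2 * ((G.card : ℤ) - 1) := by
  classical
  rw [sum_deg_sub_two D hD V hDV]
  have h := card_edges_add_one_le G hG V hV
    ((D.filter (fun d ↦ d.2.2 = true)).image (fun d ↦ (d.1, d.2.1))) ?_
  · rw [Finset.card_image_of_injOn] at h
    · lia
    · rintro ⟨x, i, c⟩ hd ⟨x', i', c'⟩ hd' h
      simp at hd hd' h ⊢
      simp [hd.2, hd'.2, h]
  · intro e he
    obtain ⟨⟨x, i, c⟩, hd, rfl⟩ := Finset.mem_image.1 he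
    obtain ⟨hd, hc⟩ := Finset.mem_filter.1 hd
    simp only at hc
    subst hc
    exact ⟨hDV _ hd, hDV _ (hD _ hd)⟩

variable {L H : Subgroup (FreeGroup ι)}

/-- The map on darts induced by the covering of Schreier graphs `F ⧸ L → F ⧸ H`. -/
def dartMap (hLH : L ≤ H) (d : (FreeGroup ι ⧸ L) × (ι × Bool)) :
    (FreeGroup ι ⧸ H) × (ι × Bool) :=
  (Subgroup.quotientMapOfLE hLH d.1, d.2)

theorem dartInv_dartMap (hLH : L ≤ H) (d : (FreeGroup ι ⧸ L) × (ι × Bool)) :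
    dartInv (dartMap hLH d) = dartMap hLH (dartInv d) := by
  obtain ⟨x, ℓ⟩ := d
  induction x using QuotientGroup.induction_on
  rfl

theorem dartMap_mem_coreDarts (hLH : L ≤ H) {d : (FreeGroup ι ⧸ L) × (ι × Bool)}
    (hd : d ∈ coreDarts L) : dartMap hLH d ∈ coreDarts H := by
  obtain ⟨a, b, h1, h2, h3⟩ := hd
  refine ⟨a, b, h1, hLH h2, ?_⟩
  rw [dartMap, ← h3]
  rfl

theorem deg_le_deg_image [DecidableEq (FreeGroup ι ⧸ L)] [DecidableEq (FreeGroup ι ⧸ H)]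
    [DecidableEq ι] (hLH : L ≤ H) (D : Finset ((FreeGroup ι ⧸ L) × (ι × Bool)))
    (x : FreeGroup ι ⧸ L) :
    deg D x ≤ deg (D.image (dartMap hLH)) (Subgroup.quotientMapOfLE hLH x) := by
  refine Finset.card_le_card_of_injOn (dartMap hLH) ?_ ?_
  · intro d hd
    simp only [Finset.coe_filter, Set.mem_ofPred_eq] at hd ⊢
    exact ⟨Finset.mem_image_of_mem _ hd.1, by rw [dartMap, hd.2]⟩
  · intro d hd d' hd' h
    simp only [Finset.coe_filter, Set.mem_ofPred_eq] at hd hd'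
    exact Prod.ext (hd.2.trans hd'.2.symm) (congrArg Prod.snd h :)

theorem sum_deg_image_sub_two_le [DecidableEq (FreeGroup ι ⧸ H)] [DecidableEq ι] (hLH : L ≤ H)
    (G : Finset (FreeGroup ι)) (hG : Subgroup.closure (G : Set (FreeGroup ι)) = H)
    (D : Finset ((FreeGroup ι ⧸ L) × (ι × Bool))) (hD : ∀ d ∈ D, dartInv d ∈ D)
    (V : Finset (FreeGroup ι ⧸ L)) (hV : V.Nonempty) (hDV : ∀ d ∈ D, d.1 ∈ V) :
    ∑ v ∈ V.image (Subgroup.quotientMapOfLE hLH), ((deg (D.image (dartMap hLH)) v : ℤ) - 2) ≤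
      2 * ((G.card : ℤ) - 1) := by
  refine sum_deg_sub_two_le G hG _ ?_ _ (hV.image _) ?_
  · intro d hd
    obtain ⟨d', hd', rfl⟩ := Finset.mem_image.1 hd
    rw [dartInv_dartMap]
    exact Finset.mem_image_of_mem _ (hD d' hd')
  · intro d hd
    obtain ⟨d', hd', rfl⟩ := Finset.mem_image.1 hd
    exact Finset.mem_image_of_mem _ (hDV d' hd')

end Degree

section Intersection

variable {ι : Type*} {H K : Subgroup (FreeGroup ι)}

theorem quotientMapOfLE_inf_injective {x y : FreeGroup ι ⧸ (H ⊓ K)}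
    (hH : Subgroup.quotientMapOfLE (inf_le_left : H ⊓ K ≤ H) x =
      Subgroup.quotientMapOfLE (inf_le_left : H ⊓ K ≤ H) y)
    (hK : Subgroup.quotientMapOfLE (inf_le_right : H ⊓ K ≤ K) x =
      Subgroup.quotientMapOfLE (inf_le_right : H ⊓ K ≤ K) y) : x = y := by
  induction x using QuotientGroup.induction_on
  induction y using QuotientGroup.induction_on
  simp only [Subgroup.quotientMapOfLE_apply_mk, QuotientGroup.eq] at hH hK ⊢
  exact ⟨hH, hK⟩

theorem coreDarts_inf_finite (hH : (coreDarts H).Finite) (hK : (coreDarts K).Finite) :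
    (coreDarts (H ⊓ K)).Finite := by
  refine Set.Finite.of_injOn (f := fun d ↦ (dartMap inf_le_left d, dartMap inf_le_right d))
    (t := coreDarts H ×ˢ coreDarts K) ?_ ?_ (hH.prod hK)
  · exact fun d hd ↦ ⟨dartMap_mem_coreDarts _ hd, dartMap_mem_coreDarts _ hd⟩
  · intro d _ d' _ h
    obtain ⟨h1, h2⟩ := Prod.ext_iff.1 h
    exact Prod.ext (quotientMapOfLE_inf_injective (congrArg Prod.fst h1) (congrArg Prod.fst h2))
      (congrArg Prod.snd h1 :)

/-- The Hanna Neumann bound when `H ⊓ K` contains a nontrivial cyclically reduced word. -/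
theorem exists_generators_inf (GH GK : Finset (FreeGroup ι))
    (hGH : Subgroup.closure (GH : Set (FreeGroup ι)) = H)
    (hGK : Subgroup.closure (GK : Set (FreeGroup ι)) = K) {w : List (ι × Bool)}
    (hw : IsCyclicallyReduced w) (hw0 : w ≠ []) (hwHK : mk w ∈ H ⊓ K) :
    ∃ G : Finset (FreeGroup ι), Subgroup.closure (G : Set (FreeGroup ι)) = H ⊓ K ∧
      (G.card : ℤ) - 1 ≤ 2 * (GH.card - 1) * (GK.card - 1) := by
  classical
  have hfin := coreDarts_inf_finite (coreDarts_finite GH hGH) (coreDarts_finite GK hGK)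
  let D := hfin.toFinset
  have hmem (d) : d ∈ D ↔ d ∈ coreDarts (H ⊓ K) := hfin.mem_toFinset
  have hDc : (D : Set ((FreeGroup ι ⧸ (H ⊓ K)) × (ι × Bool))) = coreDarts (H ⊓ K) :=
    hfin.coe_toFinset
  have hD : ∀ d ∈ D, dartInv d ∈ D := fun d hd ↦
    (hmem _).2 (dartInv_mem_coreDarts ((hmem _).1 hd))
  let V := D.image Prod.fst
  have hDV : ∀ d ∈ D, d.1 ∈ V := fun d hd ↦ Finset.mem_image_of_mem _ hd
  let x₀ : FreeGroup ι ⧸ (H ⊓ K) := ((1 : FreeGroup ι) : FreeGroup ι ⧸ (H ⊓ K))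
  have hx₀ : x₀ ∈ V := by
    obtain ⟨d, hd, -, -, h, -⟩ := exists_ne_mem_coreDarts hw hw0 hwHK x₀ (.inl rfl)
    exact Finset.mem_image.2 ⟨d, (hmem _).2 hd, h⟩
  have hdeg (v) (hv : v ∈ V) : 2 ≤ deg D v := by
    obtain ⟨d, hd, hdv⟩ := Finset.mem_image.1 hv
    obtain ⟨d₁, hd₁, d₂, hd₂, h1, h2, hne⟩ :=
      exists_ne_mem_coreDarts hw hw0 hwHK v (.inr ⟨d, (hmem _).1 hd, hdv⟩)
    exact Finset.one_lt_card.2 ⟨d₁, Finset.mem_filter.2 ⟨(hmem _).2 hd₁, h1⟩, d₂,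
      Finset.mem_filter.2 ⟨(hmem _).2 hd₂, h2⟩, hne⟩
  obtain ⟨G, hG, hcard⟩ := exists_generators D hD V hDV x₀ hx₀
    (fun v hv ↦ by
      obtain ⟨d, hd, rfl⟩ := Finset.mem_image.1 hv
      obtain ⟨a, b, h1, h2, h3⟩ := (hmem _).1 hd
      refine ⟨b, by rw [smul_base, h3], ?_⟩
      rw [hDc]
      exact reads_coreDarts (a ++ [d.2]) b (by simpa using h1) (by simpa using h2))
    (H ⊓ K) (fun g ↦ (smul_base_eq_iff g).symm)
    (fun g hg ↦ by
      refine ⟨g.toWord, FreeGroup.mk_toWord, ?_⟩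
      rw [hDc]
      exact reads_coreDarts [] g.toWord FreeGroup.isReduced_toWord
        (by rwa [List.nil_append, FreeGroup.mk_toWord]))
  refine ⟨G, hG, ?_⟩
  have hsum := sum_deg_sub_two D hD V hDV
  let πH := Subgroup.quotientMapOfLE (inf_le_left : H ⊓ K ≤ H)
  let πK := Subgroup.quotientMapOfLE (inf_le_right : H ⊓ K ≤ K)
  let dH : FreeGroup ι ⧸ H → ℤ := fun v ↦ (deg (D.image (dartMap inf_le_left)) v : ℤ) - 2
  let dK : FreeGroup ι ⧸ K → ℤ := fun v ↦ (deg (D.image (dartMap inf_le_right)) v : ℤ) - 2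
  have hsH : ∑ v ∈ V.image πH, dH v ≤ 2 * ((GH.card : ℤ) - 1) :=
    sum_deg_image_sub_two_le inf_le_left GH hGH D hD V ⟨_, hx₀⟩ hDV
  have hsK : ∑ v ∈ V.image πK, dK v ≤ 2 * ((GK.card : ℤ) - 1) :=
    sum_deg_image_sub_two_le inf_le_right GK hGK D hD V ⟨_, hx₀⟩ hDV
  have hle (v) (hv : v ∈ V) : 0 ≤ (deg D v : ℤ) - 2 ∧ (deg D v : ℤ) - 2 ≤ dH (πH v) ∧
      (deg D v : ℤ) - 2 ≤ dK (πK v) := by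
    have h1 := hdeg v hv
    have h2 := deg_le_deg_image (inf_le_left : H ⊓ K ≤ H) D v
    have h3 := deg_le_deg_image (inf_le_right : H ⊓ K ≤ K) D v
    simp only [dH, dK, πH, πK]
    lia
  have hH0 (u) (hu : u ∈ V.image πH) : 0 ≤ dH u := by
    obtain ⟨v, hv, rfl⟩ := Finset.mem_image.1 hu
    exact (hle v hv).1.trans (hle v hv).2.1
  have hK0 (u) (hu : u ∈ V.image πK) : 0 ≤ dK u := by
    obtain ⟨v, hv, rfl⟩ := Finset.mem_image.1 hu
    exact (hle v hv).1.trans (hle v hv).2.2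
  have hprod : ∑ v ∈ V, ((deg D v : ℤ) - 2) ≤
      (∑ v ∈ V.image πH, dH v) * ∑ v ∈ V.image πK, dK v := by
    have hinj : Set.InjOn (fun v ↦ (πH v, πK v)) (V : Set (FreeGroup ι ⧸ (H ⊓ K))) := by
      intro x _ y _ h
      exact quotientMapOfLE_inf_injective (congrArg Prod.fst h) (congrArg Prod.snd h)
    calc ∑ v ∈ V, ((deg D v : ℤ) - 2) ≤ ∑ v ∈ V, dH (πH v) * dK (πK v) := by
          refine Finset.sum_le_sum fun v hv ↦ ?_
          obtain ⟨h0, h1, h2⟩ := hle v hv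
          rcases h0.eq_or_lt with h | h
          · rw [← h] at h1 h2 ⊢
            positivity
          · nlinarith
      _ = ∑ p ∈ V.image (fun v ↦ (πH v, πK v)), dH p.1 * dK p.2 := by
          rw [Finset.sum_image hinj]
      _ ≤ ∑ p ∈ V.image πH ×ˢ V.image πK, dH p.1 * dK p.2 := by
          refine Finset.sum_le_sum_of_subset_of_nonneg ?_ ?_
          · intro p hp
            obtain ⟨v, hv, rfl⟩ := Finset.mem_image.1 hp
            exact Finset.mk_mem_product (Finset.mem_image_of_mem _ hv)
              (Finset.mem_image_of_mem _ hv)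
          · intro p hp _
            obtain ⟨h1, h2⟩ := Finset.mem_product.1 hp
            exact mul_nonneg (hH0 _ h1) (hK0 _ h2)
      _ = _ := by rw [Finset.sum_product, Finset.sum_mul_sum]
  have hmul : (∑ v ∈ V.image πH, dH v) * ∑ v ∈ V.image πK, dK v ≤
      (2 * ((GH.card : ℤ) - 1)) * (2 * ((GK.card : ℤ) - 1)) :=
    mul_le_mul hsH hsK (Finset.sum_nonneg hK0) ((Finset.sum_nonneg hH0).trans hsH)
  have hcard' : (G.card : ℤ) + V.card ≤ (D.filter (fun d ↦ d.2.2 = true)).card + 1 := by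
    exact_mod_cast hcard
  linarith

end Intersection

theorem exists_finset_closure_eq {F : Type*} [Group F] (H : Subgroup F) [Group.FG H] :
    ∃ G : Finset F, Subgroup.closure (G : Set F) = H ∧ G.card = Group.rank H := by
  classical
  obtain ⟨S, hS, hcl⟩ := Group.rank_spec H
  refine ⟨S.map ⟨Subtype.val, Subtype.val_injective⟩, ?_, by rw [Finset.card_map, hS]⟩
  have := congrArg (Subgroup.map H.subtype) hcl
  rw [MonoidHom.map_closure, ← MonoidHom.range_eq_map, Subgroup.range_subtype] at this
  simpa using this

theorem fg_and_rank_inf_sub_one_le {ι : Type*} (H K : Subgroup (FreeGroup ι)) [Group.FG H]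
    [Group.FG K] {w : List (ι × Bool)} (hw : IsCyclicallyReduced w) (hw0 : w ≠ [])
    (hwHK : mk w ∈ H ⊓ K) :
    ∃ _ : Group.FG ↥(H ⊓ K),
      Group.rank ↥(H ⊓ K) - 1 ≤ 2 * (Group.rank H - 1) * (Group.rank K - 1) := by
  obtain ⟨GH, hGH, hmH⟩ := exists_finset_closure_eq H
  obtain ⟨GK, hGK, hmK⟩ := exists_finset_closure_eq K
  obtain ⟨G, hG, hle⟩ := exists_generators_inf GH GK hGH hGK hw hw0 hwHK
  have hne : mk w ≠ 1 := by
    classical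
    intro h
    rw [← FreeGroup.toWord_eq_nil_iff, FreeGroup.toWord_mk, hw.1.reduce_eq] at h
    exact hw0 h
  have : Nontrivial H := (Subgroup.nontrivial_iff_exists_ne_one H).2 ⟨_, hwHK.1, hne⟩
  have : Nontrivial K := (Subgroup.nontrivial_iff_exists_ne_one K).2 ⟨_, hwHK.2, hne⟩
  have hposH := Group.rank_pos (G := H)
  have hposK := Group.rank_pos (G := K)
  rw [← hG]
  refine ⟨inferInstance, ?_⟩
  have hr := Subgroup.rank_closure_finset_le_card G
  rw [hmH, hmK] at hle
  obtain ⟨p, hp⟩ := Nat.exists_eq_add_of_lt hposH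
  obtain ⟨q, hq⟩ := Nat.exists_eq_add_of_lt hposK
  rw [hp, hq] at hle ⊢
  push_cast at hle
  simp only [zero_add, add_sub_cancel_right, add_tsub_cancel_right] at hle ⊢
  have : G.card ≤ 2 * p * q + 1 := by exact_mod_cast sub_le_iff_le_add.1 hle
  lia

open Pointwise in
theorem fg_and_rank_inf_sub_one_le_of_ne_bot {ι : Type*} (H K : Subgroup (FreeGroup ι))
    [Group.FG H] [Group.FG K] (hne : H ⊓ K ≠ ⊥) :
    ∃ _ : Group.FG ↥(H ⊓ K),
      Group.rank ↥(H ⊓ K) - 1 ≤ 2 * (Group.rank H - 1) * (Group.rank K - 1) := by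
  classical
  obtain ⟨g, hg, hg1⟩ := (Subgroup.bot_or_exists_ne_one (H ⊓ K)).resolve_left hne
  let w := reduceCyclically g.toWord
  let c : FreeGroup ι := mk (reduceCyclically.conjugator g.toWord)
  have hgc : g = c * mk w * c⁻¹ := by
    simp only [c, w, FreeGroup.inv_mk, FreeGroup.mul_mk]
    rw [reduceCyclically.conj_conjugator_reduceCyclically, FreeGroup.mk_toWord]
  let a := MulAut.conj c⁻¹
  have fgH : Group.FG ↥(a • H) := 
    Group.fg_of_surjective (f := (Subgroup.equivSMul a H).toMonoidHom)
      (Subgroup.equivSMul a H).surjective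
  have fgK : Group.FG ↥(a • K) := 
    Group.fg_of_surjective (f := (Subgroup.equivSMul a K).toMonoidHom)
      (Subgroup.equivSMul a K).surjective
  have hmem : mk w ∈ a • H ⊓ a • K := by
    rw [← Subgroup.smul_inf]
    refine ⟨g, hg, ?_⟩
    simp [a, hgc, mul_assoc]
  have hw0 : w ≠ [] := by
    intro h
    have h1 : mk ([] : List (ι × Bool)) = 1 := rfl
    rw [h, h1] at hgc
    exact hg1 (by simpa using hgc)
  obtain ⟨fgI, hle⟩ := fg_and_rank_inf_sub_one_le (a • H) (a • K)
    (reduceCyclically.isCyclicallyReduced FreeGroup.isReduced_toWord) hw0 hmem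
  let e : ↥(H ⊓ K) ≃* ↥(a • H ⊓ a • K) :=
    (Subgroup.equivSMul a (H ⊓ K)).trans (MulEquiv.subgroupCongr (Subgroup.smul_inf a H K))
  have fgI' : Group.FG ↥(H ⊓ K) := 
    Group.fg_of_surjective (f := e.symm.toMonoidHom) e.symm.surjective
  refine ⟨fgI', ?_⟩
  rw [Group.rank_congr e, Group.rank_congr (Subgroup.equivSMul a H),
    Group.rank_congr (Subgroup.equivSMul a K)]
  exact hle

end HannaNeumann

theorem stmt_7 {ι : Type} (H K : Subgroup (FreeGroup ι)) (hHne : H ≠ ⊥) (hKne : K ≠ ⊥)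
    (m n : ℕ) (hH : Group.FG ↥H) (hK : Group.FG ↥K)
    (hm : @Group.rank ↥H _ hH = m) (hn : @Group.rank ↥K _ hK = n) :
    ∃ hI : Group.FG ↥(H ⊓ K), @Group.rank ↥(H ⊓ K) _ hI - 1 ≤ 2 * (m - 1) * (n - 1) := by
  subst hm hn
  by_cases hne : H ⊓ K = ⊥
  · rw [hne]
    exact ⟨inferInstance, by rw [Group.rank_eq_zero]; exact Nat.zero_le _⟩
  · exact HannaNeumann.fg_and_rank_inf_sub_one_le_of_ne_bot H K hne
end

section
/- (H. Neumann inequality is attained) For every m, n ≥ 2 there exist subgroups H, K of the free group F(a,b) with rank(H)= m, rank(K) = n, and rank(H ∩ K) − 1 = (m−1)(n−1); in particular the Hanna Neumann bound (m−1)(n−1) is sharp. -/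
/-- For `H ≤ G` and an abelian group `X`, the functions `G → X` which, up to the translation
normalising their value at `1`, are right equivariant along a homomorphism `H →* X`. -/
def Subgroup.RightEquivariant {G : Type*} [Group G] (H : Subgroup G) (X : Type*) [CommGroup X] :
    Type _ :=
  {φ : G → X // ∀ g, ∀ h ∈ H, φ (g * h) = φ g * ((φ 1)⁻¹ * φ h)}

namespace Subgroup.RightEquivariant

variable {G X : Type*} [Group G] [CommGroup X] {H : Subgroup G}

/-- A right equivariant function amounts to a homomorphism on `H` together with values on a
transversal of `H`. -/
noncomputable def equivHomProd : H.RightEquivariant X ≃ (H →* X) × (G ⧸ H → X) where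
  toFun φ := (MonoidHom.mk' (fun h => (φ.1 1)⁻¹ * φ.1 h) fun a b => by
    rw [Subgroup.coe_mul, φ.2 _ _ b.2, mul_assoc], fun q => φ.1 q.out)
  invFun p := ⟨fun g => p.2 (g : G ⧸ H) *
      p.1 ⟨(g : G ⧸ H).out⁻¹ * g, QuotientGroup.eq.1 (QuotientGroup.out_eq' _)⟩, by
    intro g h hh
    have key : ∀ g, ∀ h : H, p.2 ((g * h : G) : G ⧸ H) * p.1 ⟨((g * h : G) : G ⧸ H).out⁻¹ * (g * h),
          QuotientGroup.eq.1 (QuotientGroup.out_eq' _)⟩ =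
        p.2 (g : G ⧸ H) * p.1 ⟨(g : G ⧸ H).out⁻¹ * g,
          QuotientGroup.eq.1 (QuotientGroup.out_eq' _)⟩ * p.1 h := by
      intro g h
      have e : ((g * h : G) : G ⧸ H) = g := QuotientGroup.mk_mul_of_mem g h.2
      simp only [e, mul_assoc, ← map_mul]
      congr 2
      ext
      simp [mul_assoc]
    have h1 := key 1 ⟨h, hh⟩
    simp only [one_mul] at h1
    dsimp only
    rw [h1, key g ⟨h, hh⟩, inv_mul_cancel_left]⟩
  left_inv φ := by
    refine Subtype.ext (funext fun g => ?_)
    have h : (g : G ⧸ H).out⁻¹ * g ∈ H := QuotientGroup.eq.1 (QuotientGroup.out_eq' _)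
    have := φ.2 (g : G ⧸ H).out _ h
    rw [mul_inv_cancel_left] at this
    exact this.symm
  right_inv p := by
    refine Prod.ext (MonoidHom.ext fun h => ?_) (funext fun q => ?_)
    · have e : ((h : G) : G ⧸ H) = (1 : G) := by
        simpa using QuotientGroup.mk_mul_of_mem (1 : G) h.2
      simp only [MonoidHom.mk'_apply, e]
      rw [mul_inv_rev, mul_assoc, inv_mul_cancel_left, ← map_inv, ← map_mul]
      congr 1
      ext
      simp
    · have e : (⟨((q.out : G) : G ⧸ H).out⁻¹ * q.out,
          QuotientGroup.eq.1 (QuotientGroup.out_eq' _)⟩ : H) = 1 := by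
        ext
        simp
      simp only [e, map_one, mul_one]
      simp

theorem map_mul_out_div (φ : H.RightEquivariant X) (s g : G) :
    φ.1 (s * (g : G ⧸ H).out) / φ.1 (g : G ⧸ H).out = φ.1 (s * g) / φ.1 g := by
  have h : (g : G ⧸ H).out⁻¹ * g ∈ H := QuotientGroup.eq.1 (QuotientGroup.out_eq' _)
  have h1 := φ.2 (g : G ⧸ H).out _ h
  have h2 := φ.2 (s * (g : G ⧸ H).out) _ h
  rw [mul_inv_cancel_left] at h1
  rw [mul_assoc, mul_inv_cancel_left] at h2
  rw [h1, h2, mul_div_mul_right_eq_div]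

variable {α : Type*} {H : Subgroup (FreeGroup α)}

/-- The value at `1` and the increments of a right equivariant function along the edges of the
Schreier graph of `H`. -/
noncomputable def increments (φ : H.RightEquivariant X) : X × (α × (FreeGroup α ⧸ H) → X) :=
  (φ.1 1, fun p => φ.1 (FreeGroup.of p.1 * p.2.out) / φ.1 p.2.out)

theorem increments_injective :
    Function.Injective (increments : H.RightEquivariant X → X × (α × (FreeGroup α ⧸ H) → X)) := by
  intro φ ψ h
  have h1 : φ.1 1 = ψ.1 1 := congrArg Prod.fst h
  have hs : ∀ s g, φ.1 (FreeGroup.of s * g) / φ.1 g = ψ.1 (FreeGroup.of s * g) / ψ.1 g := by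
    intro s g
    rw [← map_mul_out_div φ, ← map_mul_out_div ψ]
    exact congrFun (congrArg Prod.snd h) (s, (g : FreeGroup α ⧸ H))
  have key : ∀ w g, φ.1 (w * g) / φ.1 g = ψ.1 (w * g) / ψ.1 g := by
    intro w
    induction w using FreeGroup.induction_on with
    | C1 => intro g; simp
    | of s => exact hs s
    | inv_of s _ =>
      intro g
      have := hs s ((FreeGroup.of s)⁻¹ * g)
      rw [mul_inv_cancel_left] at this
      rw [← inv_inj, inv_div, inv_div]
      exact this
    | mul x y hx hy =>
      intro g
      rw [mul_assoc, ← div_mul_div_cancel (φ.1 (x * (y * g))) (φ.1 (y * g)),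
        ← div_mul_div_cancel (ψ.1 (x * (y * g))) (ψ.1 (y * g)), hx, hy]
  refine Subtype.ext (funext fun g => ?_)
  simpa [h1] using key g 1

/-- The permutation of `(FreeGroup α ⧸ H) × X` over the translation by a generator, with
prescribed increments. -/
def generatorPerm (l : α × (FreeGroup α ⧸ H) → X) (s : α) :
    Equiv.Perm ((FreeGroup α ⧸ H) × X) where
  toFun p := (FreeGroup.of s • p.1, l (s, p.1) * p.2)
  invFun p := ((FreeGroup.of s)⁻¹ • p.1, (l (s, (FreeGroup.of s)⁻¹ • p.1))⁻¹ * p.2)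
  left_inv p := by simp
  right_inv p := by simp

theorem lift_generatorPerm_apply (l : α × (FreeGroup α ⧸ H) → X) (w : FreeGroup α)
    (q : FreeGroup α ⧸ H) (x : X) :
    FreeGroup.lift (generatorPerm l) w (q, x) =
      (w • q, (FreeGroup.lift (generatorPerm l) w (q, 1)).2 * x) := by
  induction w using FreeGroup.induction_on generalizing q x with
  | C1 => simp
  | of s => simp [generatorPerm]
  | inv_of s _ => simp [generatorPerm, Equiv.Perm.inv_def]
  | mul a b ha hb =>
    rw [map_mul, Equiv.Perm.mul_apply, Equiv.Perm.mul_apply, hb q x, ha, hb q 1, ha (b • q) (_ * 1)]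
    simp [mul_smul, mul_assoc]

theorem increments_surjective :
    Function.Surjective (increments : H.RightEquivariant X → X × (α × (FreeGroup α ⧸ H) → X)) := by
  rintro ⟨x, l⟩
  let ρ := FreeGroup.lift (generatorPerm l)
  have hmul (g g' : FreeGroup α) : (ρ (g * g') ((1 : FreeGroup α), x)).2 =
      (ρ g ((g' : FreeGroup α ⧸ H), 1)).2 * (ρ g' ((1 : FreeGroup α), x)).2 := by
    rw [map_mul, Equiv.Perm.mul_apply, lift_generatorPerm_apply l g' _ x,
      lift_generatorPerm_apply l g]
    simp [ρ]
  refine ⟨⟨fun g => (ρ g ((1 : FreeGroup α), x)).2, ?_⟩, Prod.ext ?_ (funext fun p => ?_)⟩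
  · intro g h hh
    have e : (h : FreeGroup α ⧸ H) = (1 : FreeGroup α) := by
      simpa using QuotientGroup.mk_mul_of_mem (1 : FreeGroup α) hh
    dsimp only
    rw [hmul, e]
    rw [show (ρ g ((1 : FreeGroup α), x)).2 = _ from
      congrArg Prod.snd (lift_generatorPerm_apply l g _ x)]
    simp [ρ, mul_assoc]
  · simp [increments, ρ]
  · obtain ⟨s, q⟩ := p
    simp only [increments]
    rw [hmul, mul_div_cancel_right]
    simp [ρ, generatorPerm]

end Subgroup.RightEquivariant

theorem Subgroup.card_monoidHom_mul_pow_index {α X : Type*} [Finite α] [CommGroup X] [Finite X]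
    (H : Subgroup (FreeGroup α)) [H.FiniteIndex] :
    Nat.card (H →* X) * Nat.card X ^ H.index = Nat.card X ^ (1 + Nat.card α * H.index) := by
  have e := Nat.card_congr ((RightEquivariant.equivHomProd (H := H) (X := X)).symm.trans
    (Equiv.ofBijective _ ⟨RightEquivariant.increments_injective,
      RightEquivariant.increments_surjective⟩))
  simpa [Nat.card_prod, Nat.card_fun, pow_add, Subgroup.index] using e

theorem FreeGroupBasis.rank_eq {ι G : Type*} [Group G] [Group.FG G] [Finite ι]
    (b : FreeGroupBasis ι G) : Group.rank G = Nat.card ι := by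
  have := Fintype.ofFinite ι
  classical
  apply le_antisymm
  · have hb : Subgroup.closure (Set.range b) = ⊤ := by
      have := congrArg (Subgroup.map (b.repr.symm : FreeGroup ι →* G))
        (FreeGroup.closure_range_of ι)
      rw [MonoidHom.map_closure, ← Set.range_comp, ← MonoidHom.range_eq_map,
        MonoidHom.range_eq_top.2 b.repr.symm.surjective] at this
      exact this
    calc Group.rank G ≤ (Finset.univ.image b).card := Group.rank_le (by simpa using hb)
      _ ≤ Nat.card ι := by simpa using Finset.card_image_le (s := Finset.univ) (f := b)
  · obtain ⟨S, hS, hcl⟩ := Group.rank_spec G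
    have hinj : Function.Injective fun (f : G →* ℤˣ) (s : S) => f s := by
      intro f g h
      exact MonoidHom.eq_of_eqOn_dense hcl fun x hx => congrFun h ⟨x, hx⟩
    have h := Nat.card_le_card_of_injective _ (hinj.comp (b.lift (H := ℤˣ)).injective)
    rw [Nat.card_fun, Nat.card_fun, Nat.card_eq_fintype_card (α := ℤˣ), Fintype.card_units_int,
      Nat.card_eq_fintype_card (α := S), Fintype.card_coe, hS] at h
    exact (Nat.pow_le_pow_iff_right one_lt_two).1 h

/-- The Schreier index formula. -/
theorem Subgroup.rank_add_index_eq {α : Type*} [Finite α] (H : Subgroup (FreeGroup α))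
    [H.FiniteIndex] [Group.FG H] : Group.rank H + H.index = 1 + Nat.card α * H.index := by
  let b := IsFreeGroup.basis H
  have h := H.card_monoidHom_mul_pow_index (X := ℤˣ)
  rw [← Nat.card_congr (b.lift (H := ℤˣ))] at h
  have hfin : Finite (IsFreeGroup.Generators H) := by
    by_contra hinf
    rw [not_finite_iff_infinite] at hinf
    have : Nontrivial ℤˣ := ⟨1, -1, by decide⟩
    have : Infinite (IsFreeGroup.Generators H → ℤˣ) := inferInstance
    rw [Nat.card_eq_zero_of_infinite, zero_mul] at h
    exact pow_ne_zero _ (by simp) h.symm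
  rw [Nat.card_fun, Nat.card_eq_fintype_card (α := ℤˣ), Fintype.card_units_int, ← pow_add] at h
  rw [b.rank_eq]
  exact Nat.pow_right_injective le_rfl h

/-- The homomorphism `FreeGroup Bool →* ℤ/k` counting the occurrences of one generator. -/
def FreeGroup.countMod (k : ℕ) (c : Bool) : FreeGroup Bool →* Multiplicative (ZMod k) :=
  FreeGroup.lift fun d => if d = c then Multiplicative.ofAdd 1 else 1

theorem FreeGroup.countMod_prod_surjective (k l : ℕ) :
    Function.Surjective ((countMod k true).prod (countMod l false)) := by
  rintro ⟨x, y⟩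
  obtain ⟨i, hi⟩ := ZMod.intCast_surjective x.toAdd
  obtain ⟨j, hj⟩ := ZMod.intCast_surjective y.toAdd
  refine ⟨FreeGroup.of true ^ i * FreeGroup.of false ^ j, ?_⟩
  simp [countMod, ← ofAdd_zsmul, hi, hj]

theorem MonoidHom.rank_ker_of_surjective {G : Type*} [Group G] [Finite G]
    (f : FreeGroup Bool →* G) (hf : Function.Surjective f) :
    ∃ h : Group.FG f.ker, @Group.rank f.ker _ h = Nat.card G + 1 := by
  have hi : f.ker.index = Nat.card G := by
    rw [Subgroup.index_ker, MonoidHom.range_eq_top.2 hf, Subgroup.card_top]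
  have : f.ker.FiniteIndex := ⟨by rw [hi]; exact Nat.card_pos.ne'⟩
  have hfg : Group.FG f.ker := inferInstance
  refine ⟨hfg, ?_⟩
  have h := f.ker.rank_add_index_eq
  rw [hi, Nat.card_eq_fintype_card (α := Bool), Fintype.card_bool] at h
  omega

theorem stmt_18 (m n : ℕ) (hm : 2 ≤ m) (hn : 2 ≤ n) :
    ∃ (H K : Subgroup (FreeGroup Bool)) (hH : Group.FG ↥H) (hK : Group.FG ↥K)
      (hI : Group.FG ↥(H ⊓ K)),
      @Group.rank ↥H _ hH = m ∧ @Group.rank ↥K _ hK = n ∧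
      @Group.rank ↥(H ⊓ K) _ hI - 1 = (m - 1) * (n - 1) := by
  have : NeZero (m - 1) := ⟨by omega⟩
  have : NeZero (n - 1) := ⟨by omega⟩
  have hs := FreeGroup.countMod_prod_surjective (m - 1) (n - 1)
  obtain ⟨hH, rH⟩ := (FreeGroup.countMod (m - 1) true).rank_ker_of_surjective
    (Prod.fst_surjective.comp hs)
  obtain ⟨hK, rK⟩ := (FreeGroup.countMod (n - 1) false).rank_ker_of_surjective
    (Prod.snd_surjective.comp hs)
  have hr := MonoidHom.rank_ker_of_surjective _ hs
  rw [MonoidHom.ker_prod] at hr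
  obtain ⟨hI, rI⟩ := hr
  have hc (k : ℕ) : Nat.card (Multiplicative (ZMod k)) = k :=
    (Nat.card_congr Multiplicative.toAdd).trans (Nat.card_zmod k)
  simp only [Nat.card_prod, hc] at rH rK rI
  exact ⟨_, _, hH, hK, hI, by omega, by omega, by rw [rI, Nat.add_sub_cancel]⟩
end
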